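/- arXiv:0903.0641 — 2 statements merged into one kernel-verified Lean document; each statement's English description precedes it below -/
import Mathlib

section
/- For a subset N of {1, …, n} let p_N := Σ_{i ∈ N} p_i (with p_∅ = 0). Then: the prime two-sided ideals of S_n contained in a_n are exactly the ideals p_N, these 2^n ideals are pairwise distinct, each p_N is idempotent with ht(p_N) = |N|, and for a prime ideal P ≠ S_n of S_n the following are equivalent: (1) P² = P; (2) P is contained in every maximal two-sided ideal of S_n; (3) P = p_N for some subset N of {1, …, n}. In particular S_n has exactly 2^n idempotent prime ideals. -/
set_option synthInstance.maxHeartbeats 1000000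
set_option maxHeartbeats 1000000

open MvPolynomial

noncomputable section

/-- The polynomial algebra `P_n = K[x_1, …, x_n]`. -/
abbrev PolyAlg (K : Type u) [Field K] (n : ℕ) := MvPolynomial (Fin n) K

/-- `X_i` : multiplication by the variable `x_i`, as a `K`-linear endomorphism of `P_n`. -/
def Xop (K : Type u) [Field K] (n : ℕ) (i : Fin n) : Module.End K (PolyAlg K n) :=
  LinearMap.mulLeft K (X i)

/-- `Y_i` : the left inverse of `X_i`, sending a monomial `x^α` to `x^{α - e_i}` if `α i ≥ 1`
and to `0` otherwise. -/
def Yop (K : Type u) [Field K] (n : ℕ) (i : Fin n) : Module.End K (PolyAlg K n) :=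
  (basisMonomials (Fin n) K).constr K fun α =>
    if α i = 0 then 0 else monomial (α - Finsupp.single i 1) (1 : K)

/-- The algebra `S_n` of one-sided inverses of `P_n` : the subalgebra of `End_K(P_n)`
generated by `X_1, …, X_n, Y_1, …, Y_n`. -/
def SnAlg (K : Type u) [Field K] (n : ℕ) : Subalgebra K (Module.End K (PolyAlg K n)) :=
  Algebra.adjoin K (Set.range (Xop K n) ∪ Set.range (Yop K n))

/-- `x_i` as an element of `S_n`. -/
def xS (K : Type u) [Field K] (n : ℕ) (i : Fin n) : SnAlg K n :=
  ⟨Xop K n i, Algebra.subset_adjoin (Set.mem_union_left _ ⟨i, rfl⟩)⟩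

/-- `y_i` as an element of `S_n`. -/
def yS (K : Type u) [Field K] (n : ℕ) (i : Fin n) : SnAlg K n :=
  ⟨Yop K n i, Algebra.subset_adjoin (Set.mem_union_right _ ⟨i, rfl⟩)⟩

/-- The product `I*J` of two two-sided ideals: the two-sided ideal generated by all products
`a * b` with `a ∈ I`, `b ∈ J`. -/
def tsiMul {R : Type*} [Ring R] (I J : TwoSidedIdeal R) : TwoSidedIdeal R :=
  TwoSidedIdeal.span {x | ∃ a ∈ I, ∃ b ∈ J, x = a * b}

/-- A two-sided ideal `P` of a ring is prime if it is proper and for all two-sided ideals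
`I`, `J`, `I*J ⊆ P` implies `I ⊆ P` or `J ⊆ P`. -/
def tsiPrime {R : Type*} [Ring R] (P : TwoSidedIdeal R) : Prop :=
  P ≠ ⊤ ∧ ∀ I J : TwoSidedIdeal R, tsiMul I J ≤ P → I ≤ P ∨ J ≤ P

/-- There is a strictly increasing chain of prime two-sided ideals
`f 0 ⊊ f 1 ⊊ ⋯ ⊊ f m = P` of length `m` ending at `P`. -/
def primeChainTo {R : Type*} [Ring R] (P : TwoSidedIdeal R) (m : ℕ) : Prop :=
  ∃ f : Fin (m + 1) → TwoSidedIdeal R,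
    StrictMono f ∧ (∀ i, tsiPrime (f i)) ∧ f (Fin.last m) = P

/-- There is a strictly increasing chain of prime two-sided ideals
`P = f 0 ⊊ f 1 ⊊ ⋯ ⊊ f m` of length `m` starting at `P`. -/
def primeChainFrom {R : Type*} [Ring R] (P : TwoSidedIdeal R) (m : ℕ) : Prop :=
  ∃ f : Fin (m + 1) → TwoSidedIdeal R,
    StrictMono f ∧ (∀ i, tsiPrime (f i)) ∧ f 0 = P

/-- The height of the prime two-sided ideal `P` is `h` : there is a chain of primes of length `h`
ending at `P` and every such chain has length at most `h`. -/
def heightIs {R : Type*} [Ring R] (P : TwoSidedIdeal R) (h : ℕ) : Prop :=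
  primeChainTo P h ∧ ∀ m, primeChainTo P m → m ≤ h

/-- The co-height of the prime two-sided ideal `P` (the classical Krull dimension of `R/P`) is
`c` : there is a chain of primes of length `c` starting at `P` and every such chain has length
at most `c`. -/
def coheightIs {R : Type*} [Ring R] (P : TwoSidedIdeal R) (c : ℕ) : Prop :=
  primeChainFrom P c ∧ ∀ m, primeChainFrom P m → m ≤ c

/-- The ideal `p_i` of `S_n`, generated by `1 - x_i y_i`. -/
def pIdeal (K : Type u) [Field K] (n : ℕ) (i : Fin n) : TwoSidedIdeal (SnAlg K n) :=
  TwoSidedIdeal.span {1 - xS K n i * yS K n i}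

/-- The ideal `a_n = p_1 + ⋯ + p_n` of `S_n`. -/
def aIdeal (K : Type u) [Field K] (n : ℕ) : TwoSidedIdeal (SnAlg K n) := ⨆ i, pIdeal K n i

/-- The ideal `p_N = Σ_{i ∈ N} p_i` of `S_n` for a subset `N` of `{1, …, n}`. -/
def pNIdeal (K : Type u) [Field K] (n : ℕ) (N : Finset (Fin n)) : TwoSidedIdeal (SnAlg K n) :=
  ⨆ i ∈ N, pIdeal K n i

variable {K : Type*} [Field K] {n : ℕ}

theorem SnAlg.induction {p : SnAlg K n → Prop} (hx : ∀ i, p (xS K n i)) (hy : ∀ i, p (yS K n i))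
    (halg : ∀ c : K, p (algebraMap K _ c)) (hadd : ∀ s t, p s → p t → p (s + t))
    (hmul : ∀ s t, p s → p t → p (s * t)) (s : SnAlg K n) : p s := by
  obtain ⟨s, hs⟩ := s
  induction hs using Algebra.adjoin_induction with
  | mem a ha =>
    rcases ha with ⟨i, rfl⟩ | ⟨i, rfl⟩
    exacts [hx i, hy i]
  | algebraMap c => exact halg c
  | add a b ha hb iha ihb => exact hadd _ _ iha ihb
  | mul a b ha hb iha ihb => exact hmul _ _ iha ihb

theorem SnAlg.ext_apply {s t : SnAlg K n} (h : ∀ f, s.1 f = t.1 f) : s = t :=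
  Subtype.ext (LinearMap.ext h)

theorem SnAlg.mul_apply (s t : SnAlg K n) (f : PolyAlg K n) : (s * t).1 f = s.1 (t.1 f) := rfl

theorem xS_apply (i : Fin n) (f : PolyAlg K n) : (xS K n i).1 f = X i * f := rfl

theorem yS_apply (i : Fin n) (f : PolyAlg K n) :
    (yS K n i).1 f = f.divMonomial (Finsupp.single i 1) := by
  change Yop K n i f = _
  induction f using MvPolynomial.induction_on' with
  | add p q hp hq => rw [map_add, add_divMonomial, hp, hq]
  | monomial α c =>
    have : Yop K n i (monomial α c) = c • Yop K n i (monomial α 1) := by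
      rw [← map_smul, smul_monomial, smul_eq_mul, mul_one]
    have hb : monomial α (1 : K) = basisMonomials (Fin n) K α :=
      (congrFun (coe_basisMonomials (Fin n) K) α).symm
    rw [this, Yop, hb, Module.Basis.constr_basis]
    ext β
    rw [coeff_divMonomial]
    split_ifs with h
    · have : α ≠ Finsupp.single i 1 + β := by rintro rfl; simp at h
      simp [coeff_monomial, this]
    · have : α - Finsupp.single i 1 = β ↔ α = Finsupp.single i 1 + β := by
        have h1 : Finsupp.single i 1 ≤ α := by
          rw [Finsupp.single_le_iff]; omega
        rw [tsub_eq_iff_eq_add_of_le h1, add_comm]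
      simp [coeff_monomial, this]

theorem coeff_yS (i : Fin n) (f : PolyAlg K n) (α : Fin n →₀ ℕ) :
    coeff α ((yS K n i).1 f) = coeff (Finsupp.single i 1 + α) f := by
  rw [yS_apply, coeff_divMonomial]

theorem yS_mul_xS (i : Fin n) : yS K n i * xS K n i = 1 :=
  SnAlg.ext_apply fun f => by
    rw [SnAlg.mul_apply, xS_apply, yS_apply, X_mul_divMonomial]; rfl

theorem xS_comm (i j : Fin n) : Commute (xS K n i) (xS K n j) :=
  SnAlg.ext_apply fun f => mul_left_comm (X i) (X j) f

theorem yS_comm (i j : Fin n) : Commute (yS K n i) (yS K n j) :=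
  SnAlg.ext_apply fun f => by
    rw [SnAlg.mul_apply, SnAlg.mul_apply]
    ext α
    simp only [coeff_yS]
    rw [add_left_comm]

theorem divMonomial_X_mul {i : Fin n} {γ : Fin n →₀ ℕ} (h : γ i = 0) (f : PolyAlg K n) :
    (X i * f).divMonomial γ = X i * f.divMonomial γ := by
  ext α
  rw [coeff_divMonomial, coeff_X_mul', coeff_X_mul', coeff_divMonomial]
  have : i ∈ (γ + α).support ↔ i ∈ α.support := by simp [h]
  simp only [this]
  split_ifs with hi
  · congr 1
    rw [add_tsub_assoc_of_le]
    rw [Finsupp.single_le_iff]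
    have := Finsupp.mem_support_iff.1 hi
    omega
  · rfl

theorem xS_yS_comm {i j : Fin n} (h : i ≠ j) : Commute (xS K n i) (yS K n j) :=
  SnAlg.ext_apply fun f => by
    rw [SnAlg.mul_apply, SnAlg.mul_apply, xS_apply, xS_apply, yS_apply, yS_apply,
      divMonomial_X_mul (by simp [h.symm])]

variable (K n) in
/-- Multiplication by a polynomial, as an element of `S_n`. -/
def mulS : PolyAlg K n →ₐ[K] SnAlg K n :=
  (Algebra.lmul K (PolyAlg K n)).codRestrict (SnAlg K n) fun f => by
    have : (⊤ : Subalgebra K (PolyAlg K n)) ≤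
        (SnAlg K n).comap (Algebra.lmul K (PolyAlg K n)) := by
      rw [← adjoin_range_X, Algebra.adjoin_le_iff]
      rintro _ ⟨i, rfl⟩
      exact (xS K n i).2
    exact this (Algebra.mem_top (x := f))

theorem mulS_apply (f g : PolyAlg K n) : (mulS K n f).1 g = f * g := rfl

theorem mulS_X (i : Fin n) : mulS K n (X i) = xS K n i := rfl

theorem mulS_comm (f g : PolyAlg K n) : Commute (mulS K n f) (mulS K n g) := by
  rw [Commute, SemiconjBy, ← map_mul, ← map_mul, mul_comm]

theorem exists_divMonomial (γ : Fin n →₀ ℕ) :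
    ∃ d : SnAlg K n, ∀ f, d.1 f = f.divMonomial γ := by
  induction γ using Finsupp.induction_linear with
  | zero => exact ⟨1, fun f => (divMonomial_zero f).symm⟩
  | add a b ha hb =>
    obtain ⟨d, hd⟩ := ha
    obtain ⟨e, he⟩ := hb
    refine ⟨e * d, fun f => ?_⟩
    rw [divMonomial_add, ← hd, ← he]; rfl
  | single i k =>
    induction k with
    | zero => exact ⟨1, fun f => by rw [Finsupp.single_zero]; exact (divMonomial_zero f).symm⟩
    | succ k ih =>
      obtain ⟨d, hd⟩ := ih
      refine ⟨yS K n i * d, fun f => ?_⟩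
      rw [Finsupp.single_add, divMonomial_add, ← hd, ← yS_apply]; rfl

/-- Evaluation of the variables indexed by `C` at zero. -/
def evalZero (C : Finset (Fin n)) : PolyAlg K n →ₐ[K] PolyAlg K n :=
  aeval fun i => if i ∈ C then 0 else X i

theorem evalZero_X (C : Finset (Fin n)) (i : Fin n) :
    evalZero (K := K) C (X i) = if i ∈ C then 0 else X i := by
  rw [evalZero, aeval_X]

theorem coeff_evalZero (C : Finset (Fin n)) (f : PolyAlg K n) (α : Fin n →₀ ℕ) :
    coeff α (evalZero C f) = if ∀ i ∈ C, α i = 0 then coeff α f else 0 := by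
  induction f using MvPolynomial.induction_on' with
  | add p q hp hq => rw [map_add, coeff_add, hp, hq, coeff_add]; split_ifs <;> simp
  | monomial β c =>
    have key : evalZero C (monomial β c) = if ∀ i ∈ C, β i = 0 then monomial β c else 0 := by
      rw [evalZero, aeval_monomial, algebraMap_eq]
      split_ifs with h
      · rw [monomial_eq]
        congr 1
        refine Finsupp.prod_congr fun i hi => ?_
        rw [if_neg fun hC => Finsupp.mem_support_iff.1 hi (h i hC)]
      · push Not at h
        obtain ⟨i, hi, hβ⟩ := h
        rw [Finsupp.prod, Finset.prod_eq_zero (Finsupp.mem_support_iff.2 hβ), mul_zero]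
        rw [if_pos hi, zero_pow hβ]
    rw [key]
    by_cases h : α = β
    · subst h; split_ifs <;> simp
    · have h' : β ≠ α := Ne.symm h
      split_ifs <;> simp [coeff_monomial, h']

variable (K) in
/-- The idempotent `1 - x_i y_i` of `S_n`. -/
def eS (i : Fin n) : SnAlg K n := 1 - xS K n i * yS K n i

theorem eS_apply (i : Fin n) (f : PolyAlg K n) :
    (eS K i).1 f = f - X i * (yS K n i).1 f := rfl

theorem SnAlg.add_apply (s t : SnAlg K n) (f : PolyAlg K n) : (s + t).1 f = s.1 f + t.1 f := rfl

theorem SnAlg.one_apply (f : PolyAlg K n) : (1 : SnAlg K n).1 f = f := rfl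

theorem eS_add (i : Fin n) : eS K i + xS K n i * yS K n i = 1 :=
  SnAlg.ext_apply fun f => by
    rw [SnAlg.add_apply, eS_apply, SnAlg.mul_apply, xS_apply, SnAlg.one_apply, sub_add_cancel]

theorem eS_mul_xS (i : Fin n) : eS K i * xS K n i = 0 := by
  have : (eS K i + xS K n i * yS K n i) * xS K n i = xS K n i := by rw [eS_add, one_mul]
  rw [add_mul, mul_assoc, yS_mul_xS, mul_one] at this
  exact add_eq_right.1 this

theorem eS_mul_eS (i : Fin n) : eS K i * eS K i = eS K i := by
  have : eS K i * (eS K i + xS K n i * yS K n i) = eS K i := by rw [eS_add, mul_one]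
  rwa [mul_add, ← mul_assoc, eS_mul_xS, zero_mul, add_zero] at this

theorem commute_eS {i : Fin n} {s : SnAlg K n} (hx : Commute s (xS K n i))
    (hy : Commute s (yS K n i)) : Commute s (eS K i) := by
  have : s * (eS K i + xS K n i * yS K n i) = (eS K i + xS K n i * yS K n i) * s := by
    rw [eS_add, mul_one, one_mul]
  rw [mul_add, add_mul, (hx.mul_right hy).eq] at this
  exact add_right_cancel this

theorem coeff_eS (i : Fin n) (f : PolyAlg K n) (α : Fin n →₀ ℕ) :
    coeff α ((eS K i).1 f) = if α i = 0 then coeff α f else 0 := by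
  rw [eS_apply, coeff_sub, coeff_X_mul', coeff_yS]
  by_cases h : α i = 0
  · simp [h]
  · have h1 : Finsupp.single i 1 ≤ α := by
      rw [Finsupp.single_le_iff]; omega
    simp [h, add_tsub_cancel_of_le h1]

theorem evalZero_insert (C : Finset (Fin n)) (i : Fin n) (f : PolyAlg K n) :
    evalZero (insert i C) f = (eS K i).1 (evalZero C f) := by
  ext α
  rw [coeff_eS, coeff_evalZero, coeff_evalZero]
  simp only [Finset.forall_mem_insert, ite_and]

/-- The projection killing all monomials which involve a variable indexed by `C`,
as an element of `S_n`. -/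
def epsS (C : Finset (Fin n)) : SnAlg K n :=
  ⟨(evalZero C).toLinearMap, by
    induction C using Finset.induction with
    | empty =>
      convert one_mem (SnAlg K n)
      refine LinearMap.ext fun f => ?_
      change evalZero (K := K) ∅ f = f
      ext α
      simp [coeff_evalZero]
    | insert i C _ ih =>
      convert mul_mem (eS K i).2 ih using 1
      exact LinearMap.ext fun f => evalZero_insert C i f⟩

theorem epsS_apply (C : Finset (Fin n)) (f : PolyAlg K n) :
    (epsS (K := K) C).1 f = evalZero C f := rfl

theorem epsS_empty : epsS (K := K) (n := n) ∅ = 1 :=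
  SnAlg.ext_apply fun f => by
    rw [epsS_apply]
    ext α
    rw [coeff_evalZero]
    simp

theorem epsS_insert (C : Finset (Fin n)) (i : Fin n) :
    epsS (K := K) (insert i C) = eS K i * epsS C :=
  SnAlg.ext_apply fun f => evalZero_insert C i f

theorem epsS_comm_xS {C : Finset (Fin n)} {i : Fin n} (h : i ∉ C) :
    Commute (epsS (K := K) C) (xS K n i) :=
  SnAlg.ext_apply fun f => by
    rw [SnAlg.mul_apply, SnAlg.mul_apply, epsS_apply, epsS_apply, xS_apply, xS_apply, map_mul,
      evalZero_X, if_neg h]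

theorem epsS_comm_yS {C : Finset (Fin n)} {i : Fin n} (h : i ∉ C) :
    Commute (epsS (K := K) C) (yS K n i) :=
  SnAlg.ext_apply fun f => by
    rw [SnAlg.mul_apply, SnAlg.mul_apply, epsS_apply, epsS_apply]
    ext α
    rw [coeff_yS, coeff_evalZero, coeff_evalZero, coeff_yS]
    congr 1
    refine propext (forall₂_congr fun j hj => ?_)
    have : j ≠ i := by rintro rfl; exact h hj
    simp [this.symm]

theorem evalZero_mem_supported (N : Finset (Fin n)) (f : PolyAlg K n) :
    evalZero Nᶜ f ∈ supported K (N : Set (Fin n)) := by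
  have : (⊤ : Subalgebra K (PolyAlg K n)) ≤
      (supported K (N : Set (Fin n))).comap (evalZero Nᶜ) := by
    rw [← adjoin_range_X, Algebra.adjoin_le_iff]
    rintro _ ⟨i, rfl⟩
    change evalZero Nᶜ (X i) ∈ supported K (N : Set (Fin n))
    rw [evalZero_X]
    split_ifs with h
    · exact zero_mem _
    · exact X_mem_supported.2 (by simpa using h)
  exact this (Algebra.mem_top (x := f))

theorem evalZero_of_mem_supported {N : Finset (Fin n)} {f : PolyAlg K n}
    (hf : f ∈ supported K (N : Set (Fin n))) : evalZero Nᶜ f = f := by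
  have : supported K (N : Set (Fin n)) ≤
      AlgHom.equalizer (evalZero (K := K) Nᶜ) (AlgHom.id _ _) := by
    rw [supported, Algebra.adjoin_le_iff]
    rintro _ ⟨i, hi, rfl⟩
    change evalZero Nᶜ (X i) = X i
    rw [evalZero_X, if_neg (by simpa using hi)]
  exact this hf

/-- If `g` commutes with `x_i` for all `i ∈ N`, then it commutes with multiplication by every
polynomial in these variables. -/
theorem mulS_comm_of_mem_supported {N : Finset (Fin n)} {g : SnAlg K n}
    (hg : ∀ i ∈ N, Commute g (xS K n i)) {f : PolyAlg K n}
    (hf : f ∈ supported K (N : Set (Fin n))) : Commute g (mulS K n f) := by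
  have : supported K (N : Set (Fin n)) ≤ (Subalgebra.centralizer K {g}).comap (mulS K n) := by
    rw [supported, Algebra.adjoin_le_iff]
    rintro _ ⟨i, hi, rfl⟩
    change mulS K n (X i) ∈ Subalgebra.centralizer K {g}
    rw [Subalgebra.mem_centralizer_iff]
    rintro _ rfl
    exact hg i hi
  exact Subalgebra.mem_centralizer_iff K |>.1 (this hf) g rfl


variable (K) in
/-- The product of the variables indexed by `N`. -/
def prodX (N : Finset (Fin n)) : PolyAlg K n := ∏ i ∈ N, X i

theorem prodX_ne_zero (N : Finset (Fin n)) : prodX K N ≠ 0 :=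
  Finset.prod_ne_zero_iff.2 fun i _ => X_ne_zero i

theorem prodX_mem_supported (N : Finset (Fin n)) (k : ℕ) :
    prodX K N ^ k ∈ supported K (N : Set (Fin n)) :=
  pow_mem (Subalgebra.prod_mem _ fun _ hi => X_mem_supported.2 hi) k

theorem exists_mulS_prodX_eq {N : Finset (Fin n)} {i : Fin n} (hi : i ∈ N) :
    ∃ f, mulS K n (prodX K N) = xS K n i * mulS K n f :=
  ⟨∏ j ∈ N.erase i, X j, by rw [← mulS_X, ← map_mul, prodX, Finset.mul_prod_erase N _ hi]⟩

theorem exists_mul_prodX_pow (N : Finset (Fin n)) (s : SnAlg K n) :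
    ∀ m, ∃ k t, s * mulS K n (prodX K N ^ k) = mulS K n (prodX K N ^ m) * t := by
  induction s using SnAlg.induction with
  | hx i => exact fun m => ⟨m, xS K n i, mulS_comm (X i) _⟩
  | halg c => exact fun m => ⟨m, _, Algebra.commutes c _⟩
  | hadd s t hs ht =>
    intro m
    obtain ⟨k, s', hs⟩ := hs m
    obtain ⟨l, t', ht⟩ := ht m
    refine ⟨k + l, s' * mulS K n (prodX K N ^ l) + t' * mulS K n (prodX K N ^ k), ?_⟩
    rw [mul_add, ← mul_assoc, ← mul_assoc, ← hs, ← ht, add_mul, mul_assoc, mul_assoc, ← map_mul,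
      ← map_mul, ← pow_add, ← pow_add, add_comm l k]
  | hmul s t hs ht =>
    intro m
    obtain ⟨k, s', hs⟩ := hs m
    obtain ⟨l, t', ht⟩ := ht k
    exact ⟨l, s' * t', by rw [mul_assoc, ht, ← mul_assoc, hs, mul_assoc]⟩
  | hy i =>
    intro m
    by_cases hi : i ∈ N
    · obtain ⟨f, hf⟩ := exists_mulS_prodX_eq (K := K) hi
      refine ⟨m + 1, mulS K n f, ?_⟩
      rw [pow_succ', map_mul, hf, ← mul_assoc, ← mul_assoc, yS_mul_xS, one_mul]
      exact mulS_comm _ _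
    · refine ⟨m, yS K n i, mulS_comm_of_mem_supported (fun j hj => ?_) (prodX_mem_supported N m)⟩
      exact (xS_yS_comm (by rintro rfl; exact hi hj)).symm

/-- The elements annihilated by right multiplication with a power of `w` form a two-sided ideal,
provided the powers of `w` satisfy the right Ore condition. -/
def annIdeal {R : Type*} [Ring R] (w : R) (hw : ∀ s : R, ∀ m, ∃ k t, s * w ^ k = w ^ m * t) :
    TwoSidedIdeal R :=
  .mk' {a | ∃ k, a * w ^ k = 0}
    ⟨0, zero_mul _⟩
    (by
      rintro a b ⟨k, hk⟩ ⟨l, hl⟩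
      refine ⟨k + l, ?_⟩
      rw [add_mul, pow_add, ← mul_assoc, hk, zero_mul, ← pow_add, add_comm k, pow_add, ← mul_assoc,
        hl, zero_mul, add_zero])
    (by rintro a ⟨k, hk⟩; exact ⟨k, by rw [neg_mul, hk, neg_zero]⟩)
    (by rintro s a ⟨k, hk⟩; exact ⟨k, by rw [mul_assoc, hk, mul_zero]⟩)
    (by
      rintro a s ⟨m, hm⟩
      obtain ⟨k, t, h⟩ := hw s m
      exact ⟨k, by rw [mul_assoc, h, ← mul_assoc, hm, zero_mul]⟩)

theorem mem_annIdeal {R : Type*} [Ring R] {w : R} {hw} {a : R} :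
    a ∈ annIdeal w hw ↔ ∃ k, a * w ^ k = 0 := by
  rw [annIdeal, TwoSidedIdeal.mem_mk']; rfl

theorem eS_mem_pIdeal (i : Fin n) : eS K i ∈ pIdeal K n i :=
  TwoSidedIdeal.subset_span rfl

theorem pIdeal_le_pNIdeal {N : Finset (Fin n)} {i : Fin n} (hi : i ∈ N) :
    pIdeal K n i ≤ pNIdeal K n N :=
  le_iSup₂ (f := fun i (_ : i ∈ N) => pIdeal K n i) i hi

theorem pIdeal_le_iff {i : Fin n} {P : TwoSidedIdeal (SnAlg K n)} :
    pIdeal K n i ≤ P ↔ eS K i ∈ P := by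
  rw [pIdeal, TwoSidedIdeal.span_le, Set.singleton_subset_iff, SetLike.mem_coe]
  rfl

theorem pNIdeal_le_iff {N : Finset (Fin n)} {P : TwoSidedIdeal (SnAlg K n)} :
    pNIdeal K n N ≤ P ↔ ∀ i ∈ N, eS K i ∈ P := by
  rw [pNIdeal, iSup₂_le_iff]
  exact forall₂_congr fun i _ => pIdeal_le_iff

theorem aIdeal_eq : aIdeal K n = pNIdeal K n Finset.univ := by
  simp [aIdeal, pNIdeal]

theorem mem_pNIdeal_of_mul_mem {N : Finset (Fin n)} {f : PolyAlg K n}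
    (hf : ∃ k, f = prodX K N ^ k) {a : SnAlg K n} (h : a * mulS K n f ∈ pNIdeal K n N) :
    a ∈ pNIdeal K n N := by
  let S : Submonoid (PolyAlg K n) :=
    { carrier := {f | ∀ a, a * mulS K n f ∈ pNIdeal K n N → a ∈ pNIdeal K n N}
      one_mem' := fun a ha => by rwa [map_one, mul_one] at ha
      mul_mem' := fun {f g} hf hg a ha => by
        rw [map_mul, ← mul_assoc] at ha
        exact hf _ (hg _ ha) }
  have hX : ∀ i ∈ N, (X i : PolyAlg K n) ∈ S := fun i hi a ha => by
    have h1 := (pNIdeal K n N).mul_mem_right _ (yS K n i) ha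
    have h2 := (pNIdeal K n N).mul_mem_left a _ (pIdeal_le_pNIdeal hi (eS_mem_pIdeal i))
    have := (pNIdeal K n N).add_mem h2 h1
    rwa [mulS_X, mul_assoc, ← mul_add, eS_add, mul_one] at this
  obtain ⟨k, rfl⟩ := hf
  exact (pow_mem (prod_mem hX) k : prodX K N ^ k ∈ S) a h

theorem mem_pNIdeal_iff {N : Finset (Fin n)} {a : SnAlg K n} :
    a ∈ pNIdeal K n N ↔ ∃ k, a * mulS K n (prodX K N ^ k) = 0 := by
  constructor
  · intro ha
    have hw : ∀ s : SnAlg K n, ∀ m, ∃ k t, s * mulS K n (prodX K N) ^ k =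
        mulS K n (prodX K N) ^ m * t := by
      simpa only [map_pow] using exists_mul_prodX_pow N
    have : pNIdeal K n N ≤ annIdeal _ hw := by
      rw [pNIdeal_le_iff]
      intro i hi
      obtain ⟨f, hf⟩ := exists_mulS_prodX_eq (K := K) hi
      refine mem_annIdeal.2 ⟨1, ?_⟩
      rw [pow_one, hf, ← mul_assoc, eS_mul_xS, zero_mul]
    obtain ⟨k, hk⟩ := mem_annIdeal.1 (this ha)
    exact ⟨k, by rw [map_pow, hk]⟩
  · rintro ⟨k, hk⟩
    exact mem_pNIdeal_of_mul_mem ⟨k, rfl⟩ (by rw [hk]; exact zero_mem _)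

theorem exists_mul_mulS_eq_one (N : Finset (Fin n)) (k : ℕ) :
    ∃ s, s * mulS K n (prodX K N ^ k) = 1 := by
  let S : Submonoid (PolyAlg K n) :=
    { carrier := {f | ∃ s, s * mulS K n f = 1}
      one_mem' := ⟨1, by rw [map_one, mul_one]⟩
      mul_mem' := by
        rintro f g ⟨s, hs⟩ ⟨t, ht⟩
        refine ⟨t * s, ?_⟩
        rw [map_mul, mul_assoc, ← mul_assoc s, hs, one_mul, ht] }
  have hX : ∀ i ∈ N, (X i : PolyAlg K n) ∈ S := fun i _ => ⟨yS K n i, yS_mul_xS i⟩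
  exact (pow_mem (prod_mem hX) k : prodX K N ^ k ∈ S)

theorem mulS_notMem_pNIdeal (N : Finset (Fin n)) {f : PolyAlg K n} (hf : f ≠ 0) :
    mulS K n f ∉ pNIdeal K n N := by
  rw [mem_pNIdeal_iff]
  rintro ⟨k, hk⟩
  have : (mulS K n f * mulS K n (prodX K N ^ k)).1 1 = 0 := by rw [hk]; rfl
  rw [← map_mul, mulS_apply, mul_one] at this
  exact mul_ne_zero hf (pow_ne_zero _ (prodX_ne_zero N)) this

theorem eS_mem_pNIdeal_iff {N : Finset (Fin n)} {i : Fin n} :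
    eS K i ∈ pNIdeal K n N ↔ i ∈ N := by
  refine ⟨fun h => ?_, fun h => pIdeal_le_pNIdeal h (eS_mem_pIdeal i)⟩
  by_contra hi
  obtain ⟨k, hk⟩ := mem_pNIdeal_iff.1 h
  have h1 : (eS K i) * mulS K n (prodX K N ^ k) =
      mulS K n (prodX K N ^ k) * (eS K i) := by
    refine mulS_comm_of_mem_supported (fun j hj => ?_) (prodX_mem_supported N k)
    have : j ≠ i := by rintro rfl; exact hi hj
    exact (commute_eS (xS_comm j i) (xS_yS_comm this)).symm
  rw [h1] at hk
  have h2 : (mulS K n (prodX K N ^ k) * (eS K i)).1 1 = 0 := by rw [hk]; rfl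
  have h3 : (eS K i).1 1 = 1 := by
    ext α
    rw [coeff_eS]
    split_ifs with h
    · rfl
    · rw [coeff_one, if_neg]
      rintro rfl
      exact h rfl
  rw [SnAlg.mul_apply, mulS_apply, h3, mul_one] at h2
  exact pow_ne_zero _ (prodX_ne_zero N) h2

theorem pNIdeal_le_pNIdeal_iff {M N : Finset (Fin n)} :
    pNIdeal K n M ≤ pNIdeal K n N ↔ M ⊆ N := by
  rw [pNIdeal_le_iff]
  simp only [eS_mem_pNIdeal_iff]
  rfl

theorem pNIdeal_injective : Function.Injective (pNIdeal K n) := fun _ _ h =>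
  (pNIdeal_le_pNIdeal_iff.1 h.le).antisymm (pNIdeal_le_pNIdeal_iff.1 h.ge)

theorem pNIdeal_ne_top (N : Finset (Fin n)) : pNIdeal K n N ≠ ⊤ := fun h =>
  mulS_notMem_pNIdeal N (one_ne_zero (α := PolyAlg K n)) (h ▸ TwoSidedIdeal.mem_top _)

theorem tsiMul_le {R : Type*} [Ring R] {I J P : TwoSidedIdeal R} :
    tsiMul I J ≤ P ↔ ∀ a ∈ I, ∀ b ∈ J, a * b ∈ P := by
  rw [tsiMul, TwoSidedIdeal.span_le]
  constructor
  · exact fun h a ha b hb => h ⟨a, ha, b, hb, rfl⟩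
  · rintro h _ ⟨a, ha, b, hb, rfl⟩
    exact h a ha b hb

theorem mul_mem_tsiMul {R : Type*} [Ring R] {I J : TwoSidedIdeal R} {a b : R} (ha : a ∈ I)
    (hb : b ∈ J) : a * b ∈ tsiMul I J :=
  tsiMul_le.1 le_rfl a ha b hb

theorem tsiMul_pNIdeal_self (N : Finset (Fin n)) :
    tsiMul (pNIdeal K n N) (pNIdeal K n N) = pNIdeal K n N := by
  refine le_antisymm (tsiMul_le.2 fun a _ b hb => TwoSidedIdeal.mul_mem_left _ _ _ hb) ?_
  rw [pNIdeal_le_iff]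
  intro i hi
  have h := pIdeal_le_pNIdeal hi (eS_mem_pIdeal (K := K) i)
  rw [← eS_mul_eS]
  exact mul_mem_tsiMul h h

theorem tsiPrime_iff {R : Type*} [Ring R] {P : TwoSidedIdeal R} :
    tsiPrime P ↔ P ≠ ⊤ ∧ ∀ a b, (∀ s, a * s * b ∈ P) → a ∈ P ∨ b ∈ P := by
  refine and_congr_right fun _ => ⟨fun h a b hab => ?_, fun h I J hIJ => ?_⟩
  · let B : TwoSidedIdeal R := .mk' {b | ∀ s, a * s * b ∈ P}
      (fun s => by rw [mul_zero]; exact zero_mem _)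
      (fun hx hy s => by rw [mul_add]; exact P.add_mem (hx s) (hy s))
      (fun hx s => by rw [mul_neg]; exact P.neg_mem (hx s))
      (fun {x y} hx s => by rw [← mul_assoc, mul_assoc a]; exact hx _)
      (fun hx s => by rw [← mul_assoc]; exact P.mul_mem_right _ _ (hx s))
    have hB : ∀ x ∈ TwoSidedIdeal.span {b}, ∀ s, a * s * x ∈ P := by
      have : TwoSidedIdeal.span {b} ≤ B := by
        rw [TwoSidedIdeal.span_le, Set.singleton_subset_iff, SetLike.mem_coe,
          TwoSidedIdeal.mem_mk']
        exact hab
      exact fun x hx => (TwoSidedIdeal.mem_mk' _ _ _ _ _ _ _).1 (this hx)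
    let A : TwoSidedIdeal R := .mk' {a | ∀ x ∈ TwoSidedIdeal.span {b}, ∀ s, a * s * x ∈ P}
      (fun x _ s => by rw [zero_mul, zero_mul]; exact zero_mem _)
      (fun hx hy z hz s => by rw [add_mul, add_mul]; exact P.add_mem (hx z hz s) (hy z hz s))
      (fun hx z hz s => by rw [neg_mul, neg_mul]; exact P.neg_mem (hx z hz s))
      (fun hx z hz s => by
        rw [mul_assoc, mul_assoc, ← mul_assoc _ s]; exact P.mul_mem_left _ _ (hx z hz s))
      (fun hx z hz s => by rw [mul_assoc _ _ s]; exact hx z hz _)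
    have hA : TwoSidedIdeal.span {a} ≤ A := by
      rw [TwoSidedIdeal.span_le, Set.singleton_subset_iff, SetLike.mem_coe, TwoSidedIdeal.mem_mk']
      exact hB
    have key := h (TwoSidedIdeal.span {a}) (TwoSidedIdeal.span {b}) (tsiMul_le.2 fun x hx y hy => by
      have := (TwoSidedIdeal.mem_mk' _ _ _ _ _ _ _).1 (hA hx) y hy 1
      rwa [mul_one] at this)
    exact key.imp (fun h => h (TwoSidedIdeal.subset_span rfl))
      (fun h => h (TwoSidedIdeal.subset_span rfl))
  · by_contra! hc
    obtain ⟨a, haI, haP⟩ := SetLike.not_le_iff_exists.1 hc.1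
    obtain ⟨b, hbJ, hbP⟩ := SetLike.not_le_iff_exists.1 hc.2
    rcases h a b fun s => tsiMul_le.1 hIJ _ (I.mul_mem_right _ _ haI) _ hbJ with h | h
    exacts [haP h, hbP h]

section QuotientMap

variable {A : Type*} [Ring A] {φ : SnAlg K n →+* A} {i : Fin n}

theorem map_xS_mul_map_yS (h : φ (eS K i) = 0) : φ (xS K n i) * φ (yS K n i) = 1 := by
  rw [← map_mul, ← zero_add (φ _), ← h, ← map_add, eS_add, map_one]

theorem map_yS_mul_map_xS : φ (yS K n i) * φ (xS K n i) = 1 := by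
  rw [← map_mul, yS_mul_xS, map_one]

theorem commute_map_xS (h : φ (eS K i) = 0) (s : SnAlg K n) : Commute (φ (xS K n i)) (φ s) := by
  induction s using SnAlg.induction with
  | hx j => exact (xS_comm i j).map φ
  | hy j =>
    by_cases hij : i = j
    · subst hij
      exact (map_xS_mul_map_yS h).trans map_yS_mul_map_xS.symm
    · exact (xS_yS_comm hij).map φ
  | halg c => exact Commute.map (Algebra.commutes c (xS K n i)).symm φ
  | hadd s t hs ht => rw [map_add]; exact hs.add_right ht
  | hmul s t hs ht => rw [map_mul]; exact hs.mul_right ht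

theorem commute_map_yS (h : φ (eS K i) = 0) (s : SnAlg K n) : Commute (φ (yS K n i)) (φ s) :=
  calc φ (yS K n i) * φ s = φ (yS K n i) * φ s * (φ (xS K n i) * φ (yS K n i)) := by
        rw [map_xS_mul_map_yS h, mul_one]
    _ = φ s * φ (yS K n i) := by
        rw [mul_assoc, ← mul_assoc (φ s), ← (commute_map_xS h s).eq, mul_assoc, ← mul_assoc,
          map_yS_mul_map_xS, one_mul]

theorem commute_map_mulS {N : Finset (Fin n)} (h : ∀ i ∈ N, φ (eS K i) = 0) {f : PolyAlg K n}
    (hf : f ∈ supported K (N : Set (Fin n))) (s : SnAlg K n) :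
    Commute (φ (mulS K n f)) (φ s) := by
  induction hf using Algebra.adjoin_induction with
  | mem a ha =>
    obtain ⟨i, hi, rfl⟩ := ha
    exact commute_map_xS (h i hi) s
  | algebraMap c =>
    rw [AlgHom.commutes]
    exact Commute.map (Algebra.commutes c s) φ
  | add a b _ _ ha hb => rw [map_add, map_add]; exact ha.add_left hb
  | mul a b _ _ ha hb => rw [map_mul, map_mul]; exact ha.mul_left hb

theorem commute_map_of_forall (h : ∀ i, φ (eS K i) = 0) (s t : SnAlg K n) :
    Commute (φ s) (φ t) := by
  induction s using SnAlg.induction with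
  | hx i => exact commute_map_xS (h i) t
  | hy i => exact commute_map_yS (h i) t
  | halg c => exact Commute.map (Algebra.commutes c t) φ
  | hadd r s hr hs => rw [map_add]; exact hr.add_left hs
  | hmul r s hr hs => rw [map_mul]; exact hr.mul_left hs

end QuotientMap

theorem TwoSidedIdeal.ringCon_mk'_eq_zero_iff {R : Type*} [Ring R] {P : TwoSidedIdeal R} {a : R} :
    P.ringCon.mk' a = 0 ↔ a ∈ P := by
  rw [← TwoSidedIdeal.mem_ker, TwoSidedIdeal.ker_ringCon_mk']

theorem TwoSidedIdeal.ringCon_mk'_eq_iff {R : Type*} [Ring R] {P : TwoSidedIdeal R} {a b : R} :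
    P.ringCon.mk' a = P.ringCon.mk' b ↔ a - b ∈ P := by
  rw [← TwoSidedIdeal.ringCon_mk'_eq_zero_iff, map_sub, sub_eq_zero]

theorem SnAlg.sub_apply (s t : SnAlg K n) (f : PolyAlg K n) : (s - t).1 f = s.1 f - t.1 f := rfl

theorem exists_mul_mulS_eq_of_ringCon {N : Finset (Fin n)} {s t : SnAlg K n}
    (h : (pNIdeal K n N).ringCon.mk' s = (pNIdeal K n N).ringCon.mk' t) :
    ∃ k, s * mulS K n (prodX K N ^ k) = t * mulS K n (prodX K N ^ k) := by
  obtain ⟨k, hk⟩ := mem_pNIdeal_iff.1 (TwoSidedIdeal.ringCon_mk'_eq_iff.1 h)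
  refine ⟨k, SnAlg.ext_apply fun f => ?_⟩
  have := congrArg (fun z : SnAlg K n => z.1 f) hk
  rw [SnAlg.mul_apply, SnAlg.sub_apply] at this
  exact sub_eq_zero.1 this

theorem exists_commute_mul_prodX (N : Finset (Fin n)) (a : SnAlg K n) :
    ∃ k, ∀ i ∈ N, Commute (a * mulS K n (prodX K N ^ k)) (xS K n i) := by
  have (i : Fin n) : ∃ k, i ∈ N →
      xS K n i * a * mulS K n (prodX K N ^ k) = a * xS K n i * mulS K n (prodX K N ^ k) := by
    by_cases hi : i ∈ N
    · obtain ⟨k, hk⟩ := exists_mul_mulS_eq_of_ringCon (N := N) (s := xS K n i * a)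
        (t := a * xS K n i) (by
          rw [map_mul, map_mul]
          exact commute_map_xS
            (TwoSidedIdeal.ringCon_mk'_eq_zero_iff.2 (eS_mem_pNIdeal_iff.2 hi)) a)
      exact ⟨k, fun _ => hk⟩
    · exact ⟨0, fun h => absurd h hi⟩
  choose k hk using this
  refine ⟨∑ i, k i, fun i hi => ?_⟩
  obtain ⟨l, hl⟩ := Nat.exists_eq_add_of_le
    (Finset.single_le_sum (f := k) (fun _ _ => Nat.zero_le _) (Finset.mem_univ i))
  have hx := mulS_comm (K := K) (X i) (prodX K N ^ ∑ i, k i)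
  rw [mulS_X] at hx
  refine Commute.symm ?_
  rw [Commute, SemiconjBy, mul_assoc a, ← hx.eq, ← mul_assoc, ← mul_assoc, hl, pow_add, map_mul,
    ← mul_assoc, ← mul_assoc, hk i hi]

theorem apply_eq_of_commute {g : SnAlg K n} {f : PolyAlg K n} (h : Commute g (mulS K n f)) :
    g.1 f = f * g.1 1 := by
  have := congrArg (fun z : SnAlg K n => z.1 1) h.eq
  rw [SnAlg.mul_apply, SnAlg.mul_apply, mulS_apply, mulS_apply, mul_one] at this
  exact this

theorem exists_monomial_apply_ne_zero {g : SnAlg K n} (hg : g ≠ 0) :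
    ∃ β, g.1 (monomial β 1) ≠ 0 := by
  by_contra! h
  refine hg (Subtype.ext ((basisMonomials (Fin n) K).ext fun β => ?_))
  rw [coe_basisMonomials]
  exact h β

/-- Every element outside `p_N` has a multiple of the form `f ε`, where `f` is a nonzero polynomial
in the variables indexed by `N` and `ε` is the projection killing the other variables. -/
theorem exists_mul_mul_eq {N : Finset (Fin n)} {a : SnAlg K n} (ha : a ∉ pNIdeal K n N) :
    ∃ u v, ∃ f ∈ supported K (N : Set (Fin n)), f ≠ 0 ∧ u * a * v = mulS K n f * epsS Nᶜ := by
  obtain ⟨k, hk⟩ := exists_commute_mul_prodX N a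
  have hg : a * mulS K n (prodX K N ^ k) ≠ 0 := fun h => ha (mem_pNIdeal_iff.2 ⟨k, h⟩)
  obtain ⟨β, hβ⟩ := exists_monomial_apply_ne_zero hg
  obtain ⟨α, hα⟩ := ne_zero_iff.1 hβ
  obtain ⟨d, hd⟩ := exists_divMonomial (K := K) (α.filter (· ∉ N))
  have hdx : ∀ i ∈ N, Commute d (xS K n i) := fun i hi => SnAlg.ext_apply fun f => by
    rw [SnAlg.mul_apply, SnAlg.mul_apply, hd, hd, xS_apply, xS_apply, divMonomial_X_mul]
    rw [Finsupp.filter_apply_neg]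
    simpa using hi
  have ht : ∀ i ∈ N, Commute
      (epsS Nᶜ * d * (a * mulS K n (prodX K N ^ k)) * mulS K n (monomial β 1)) (xS K n i) :=
    fun i hi => (((epsS_comm_xS (by simpa using hi)).mul_left (hdx i hi)).mul_left
      (hk i hi)).mul_left (mulS_comm _ (X i))
  have ht1 : (epsS Nᶜ * d * (a * mulS K n (prodX K N ^ k)) * mulS K n (monomial β 1)).1 1 =
      evalZero Nᶜ (((a * mulS K n (prodX K N ^ k)).1 (monomial β 1)).divMonomial
        (α.filter (· ∉ N))) := by
    rw [SnAlg.mul_apply, SnAlg.mul_apply, SnAlg.mul_apply (epsS Nᶜ), mulS_apply, mul_one, hd,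
      epsS_apply]
  refine ⟨epsS Nᶜ * d, mulS K n (prodX K N ^ k) * mulS K n (monomial β 1) * epsS Nᶜ, _,
    evalZero_mem_supported N (((a * mulS K n (prodX K N ^ k)).1 (monomial β 1)).divMonomial
        (α.filter (· ∉ N))), ?_, ?_⟩
  · refine ne_zero_iff.2 ⟨α.filter (· ∈ N), ?_⟩
    rw [coeff_evalZero, if_pos, coeff_divMonomial, add_comm, Finsupp.filter_add_filter_not]
    · exact hα
    · intro i hi
      exact Finsupp.filter_apply_neg _ _ (by simpa using hi)
  · rw [← ht1]
    refine SnAlg.ext_apply fun p => ?_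
    have := apply_eq_of_commute (mulS_comm_of_mem_supported ht (evalZero_mem_supported N p))
    rw [SnAlg.mul_apply (mulS K n _), mulS_apply, epsS_apply, mul_comm, ← this, ← epsS_apply,
      ← SnAlg.mul_apply]
    simp only [mul_assoc]

theorem tsiPrime_pNIdeal (N : Finset (Fin n)) : tsiPrime (pNIdeal K n N) := by
  refine tsiPrime_iff.2 ⟨pNIdeal_ne_top N, fun a b h => ?_⟩
  by_contra! hc
  obtain ⟨u, v, f, hf, hf0, hu⟩ := exists_mul_mul_eq hc.1
  obtain ⟨u', v', f', hf', hf0', hu'⟩ := exists_mul_mul_eq hc.2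
  have := (pNIdeal K n N).mul_mem_right _ v' ((pNIdeal K n N).mul_mem_left u _ (h (v * u')))
  have h1 : u * (a * (v * u') * b) * v' = (u * a * v) * (u' * b * v') := by
    simp only [mul_assoc]
  rw [h1, hu, hu'] at this
  obtain ⟨k, hk⟩ := mem_pNIdeal_iff.1 this
  have h2 := congrArg (fun z : SnAlg K n => z.1 1) hk
  rw [SnAlg.mul_apply, SnAlg.mul_apply, SnAlg.mul_apply, SnAlg.mul_apply, mulS_apply, mulS_apply,
    mulS_apply, epsS_apply, epsS_apply, mul_one,
    evalZero_of_mem_supported (prodX_mem_supported N k),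
    evalZero_of_mem_supported (mul_mem hf' (prodX_mem_supported N k))] at h2
  exact mul_ne_zero hf0 (mul_ne_zero hf0' (pow_ne_zero _ (prodX_ne_zero N))) h2

theorem eS_mul_mul_epsS_mem {P : TwoSidedIdeal (SnAlg K n)} {C : Finset (Fin n)} {i : Fin n}
    (hi : i ∉ C) (h : eS K i * epsS C ∈ P) (s : SnAlg K n) : eS K i * s * epsS C ∈ P := by
  let T : AddSubmonoid (SnAlg K n) := AddSubmonoid.closure {s | ∃ u v, s = u * v ∧
    Commute u (xS K n i) ∧ Commute u (yS K n i) ∧ Commute (epsS C) v}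
  have hT : ∀ t ∈ T, eS K i * t * epsS C ∈ P := fun t ht => by
    induction ht using AddSubmonoid.closure_induction with
    | mem t ht =>
      obtain ⟨u, v, rfl, hux, huy, hv⟩ := ht
      have := P.mul_mem_right _ v (P.mul_mem_left u _ h)
      rwa [← mul_assoc, (commute_eS hux huy).eq, mul_assoc, hv.eq, mul_assoc, ← mul_assoc u,
        ← mul_assoc] at this
    | zero => rw [mul_zero, zero_mul]; exact P.zero_mem
    | add a b _ _ ha hb => rw [mul_add, add_mul]; exact P.add_mem ha hb
  have key : ∀ t ∈ T, s * t ∈ T := by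
    have hgen (w : SnAlg K n) (hw : ∀ u v, Commute u (xS K n i) → Commute u (yS K n i) →
        Commute (epsS C) v → w * (u * v) ∈ T) : ∀ t ∈ T, w * t ∈ T := fun t ht => by
      induction ht using AddSubmonoid.closure_induction with
      | mem t ht =>
        obtain ⟨u, v, rfl, hux, huy, hv⟩ := ht
        exact hw u v hux huy hv
      | zero => rw [mul_zero]; exact T.zero_mem
      | add a b _ _ ha hb => rw [mul_add]; exact T.add_mem ha hb
    have hleft (w : SnAlg K n) (hx : Commute w (xS K n i)) (hy : Commute w (yS K n i)) :
        ∀ t ∈ T, w * t ∈ T :=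
      hgen w fun u v hux huy hv => AddSubmonoid.subset_closure
        ⟨w * u, v, (mul_assoc _ _ _).symm, hx.mul_left hux, hy.mul_left huy, hv⟩
    induction s using SnAlg.induction with
    | hx j =>
      by_cases hij : i = j
      · subst hij
        exact hgen _ fun u v hux huy hv => AddSubmonoid.subset_closure
          ⟨u, xS K n i * v, by rw [← mul_assoc, ← hux.eq, mul_assoc], hux, huy,
            (epsS_comm_xS hi).mul_right hv⟩
      · exact hleft _ (xS_comm j i) (xS_yS_comm (Ne.symm hij))
    | hy j =>
      by_cases hij : i = j
      · subst hij
        exact hgen _ fun u v hux huy hv => AddSubmonoid.subset_closure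
          ⟨u, yS K n i * v, by rw [← mul_assoc, ← huy.eq, mul_assoc], hux, huy,
            (epsS_comm_yS hi).mul_right hv⟩
      · exact hleft _ (xS_yS_comm hij).symm (yS_comm j i)
    | halg c => exact hleft _ (Algebra.commutes c _) (Algebra.commutes c _)
    | hadd s t hs ht =>
      exact fun r hr => by rw [add_mul]; exact T.add_mem (hs r hr) (ht r hr)
    | hmul s t hs ht => exact fun r hr => by rw [mul_assoc]; exact hs _ (ht r hr)
  have h1 : (1 : SnAlg K n) ∈ T := AddSubmonoid.subset_closure
    ⟨1, 1, (mul_one _).symm, Commute.one_left _, Commute.one_left _, Commute.one_right _⟩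
  have := hT _ (key 1 h1)
  rwa [mul_one] at this

theorem tsiPrime.one_notMem {R : Type*} [Ring R] {P : TwoSidedIdeal R} (hP : tsiPrime P) :
    (1 : R) ∉ P := fun h => hP.1 ((TwoSidedIdeal.one_mem_iff P).1 h)

theorem exists_eS_mem_of_epsS_mem {P : TwoSidedIdeal (SnAlg K n)} (hP : tsiPrime P)
    {C : Finset (Fin n)} (h : epsS C ∈ P) : ∃ i ∈ C, eS K i ∈ P := by
  induction C using Finset.induction with
  | empty => exact absurd (epsS_empty (K := K) (n := n) ▸ h) hP.one_notMem
  | insert i C hi ih =>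
    rw [epsS_insert] at h
    rcases (tsiPrime_iff.1 hP).2 _ _ (eS_mul_mul_epsS_mem hi h) with h | h
    · exact ⟨i, Finset.mem_insert_self _ _, h⟩
    · obtain ⟨j, hj, h⟩ := ih h
      exact ⟨j, Finset.mem_insert_of_mem hj, h⟩

theorem eq_pNIdeal_of_le_aIdeal {P : TwoSidedIdeal (SnAlg K n)} (hP : tsiPrime P)
    (hle : P ≤ aIdeal K n) : ∃ N, P = pNIdeal K n N := by
  classical
  let N : Finset (Fin n) := {i | eS K i ∈ P}
  have hN : ∀ i, i ∈ N ↔ eS K i ∈ P := fun i => by simp [N]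
  have hNP : pNIdeal K n N ≤ P := pNIdeal_le_iff.2 fun i hi => (hN i).1 hi
  refine ⟨N, le_antisymm (fun a ha => ?_) hNP⟩
  by_contra haN
  obtain ⟨u, v, f, hf, hf0, h⟩ := exists_mul_mul_eq haN
  have hmem : mulS K n f * epsS Nᶜ ∈ P := h ▸ P.mul_mem_right _ v (P.mul_mem_left u _ ha)
  have key : ∀ s, mulS K n f * s * epsS Nᶜ ∈ P := fun s => by
    rw [← TwoSidedIdeal.ringCon_mk'_eq_zero_iff] at hmem ⊢
    have hc := commute_map_mulS (φ := P.ringCon.mk') (N := N)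
      (fun i hi => TwoSidedIdeal.ringCon_mk'_eq_zero_iff.2 ((hN i).1 hi)) hf s
    rw [map_mul, map_mul, hc.eq, mul_assoc, ← map_mul, hmem, mul_zero]
  rcases (tsiPrime_iff.1 hP).2 _ _ key with h | h
  · have := hle h
    rw [aIdeal_eq] at this
    exact mulS_notMem_pNIdeal _ hf0 this
  · obtain ⟨i, hi, h⟩ := exists_eS_mem_of_epsS_mem hP h
    exact (Finset.mem_compl.1 hi) ((hN i).2 h)

theorem pNIdeal_le_aIdeal (N : Finset (Fin n)) : pNIdeal K n N ≤ aIdeal K n := by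
  rw [aIdeal_eq]
  exact pNIdeal_le_pNIdeal_iff.2 (Finset.subset_univ N)

theorem tsiPrime_and_le_aIdeal_iff {P : TwoSidedIdeal (SnAlg K n)} :
    tsiPrime P ∧ P ≤ aIdeal K n ↔ ∃ N, P = pNIdeal K n N := by
  refine ⟨fun h => eq_pNIdeal_of_le_aIdeal h.1 h.2, ?_⟩
  rintro ⟨N, rfl⟩
  exact ⟨tsiPrime_pNIdeal N, pNIdeal_le_aIdeal N⟩

theorem primeChainTo_succ {R : Type*} [Ring R] {P Q : TwoSidedIdeal R} {m : ℕ}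
    (hP : primeChainTo P m) (hQ : tsiPrime Q) (hPQ : P < Q) : primeChainTo Q (m + 1) := by
  obtain ⟨f, hf, hfP, rfl⟩ := hP
  refine ⟨Fin.snoc (α := fun _ => TwoSidedIdeal R) f Q, ?_, ?_, Fin.snoc_last _ _⟩
  · rw [Fin.strictMono_iff_lt_succ]
    intro i
    induction i using Fin.lastCases with
    | last => rw [Fin.snoc_castSucc, Fin.succ_last, Fin.snoc_last]; exact hPQ
    | cast i =>
      rw [Fin.snoc_castSucc, Fin.succ_castSucc, Fin.snoc_castSucc]
      exact hf i.castSucc_lt_succ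
  · intro i
    induction i using Fin.lastCases with
    | last => rw [Fin.snoc_last]; exact hQ
    | cast i => rw [Fin.snoc_castSucc]; exact hfP i

theorem heightIs_pNIdeal (N : Finset (Fin n)) : heightIs (pNIdeal K n N) N.card := by
  constructor
  · induction N using Finset.induction with
    | empty =>
      exact ⟨fun _ => pNIdeal K n ∅, Subsingleton.strictMono (α := Fin 1) _,
        fun _ => tsiPrime_pNIdeal ∅, rfl⟩
    | insert i N hi ih =>
      rw [Finset.card_insert_of_notMem hi]
      refine primeChainTo_succ ih (tsiPrime_pNIdeal _) (lt_iff_le_not_ge.2 ⟨?_, ?_⟩)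
      · exact pNIdeal_le_pNIdeal_iff.2 (Finset.subset_insert i N)
      · exact fun h => hi (pNIdeal_le_pNIdeal_iff.1 h (Finset.mem_insert_self i N))
  · rintro m ⟨f, hf, hfP, hfl⟩
    have this (j : Fin (m + 1)) : ∃ M, f j = pNIdeal K n M :=
      eq_pNIdeal_of_le_aIdeal (hfP j)
        ((hf.monotone (Fin.le_last j)).trans (hfl.le.trans (pNIdeal_le_aIdeal N)))
    choose M hM using this
    have hMN : M (Fin.last m) = N := pNIdeal_injective ((hM _).symm.trans hfl)
    have hmono : StrictMono M := fun i j hij => by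
      have := hf hij
      rw [hM, hM, lt_iff_le_not_ge, pNIdeal_le_pNIdeal_iff, pNIdeal_le_pNIdeal_iff] at this
      exact this
    have hcard : StrictMono fun j => (M j).card := Finset.card_strictMono.comp hmono
    have hle (j : ℕ) (hj : j < m + 1) : j ≤ (M ⟨j, hj⟩).card := by
      induction j with
      | zero => exact Nat.zero_le _
      | succ j ih =>
        exact (ih (by omega)).trans_lt (hcard (a := ⟨j, by omega⟩) (b := ⟨j + 1, hj⟩)
          (Fin.mk_lt_mk.2 j.lt_succ_self))
    have := hle m (by omega)
    rwa [← hMN]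

section CommutativeQuotient

universe v

variable {R : Type v} [Ring R]

theorem exists_commRing_of_ringCon_mul_comm (I : TwoSidedIdeal R)
    (h : ∀ s t, I.ringCon (s * t) (t * s)) :
    ∃ (A : Type v) (_ : CommRing A) (π : R →+* A),
      Function.Surjective π ∧ ∀ s, π s = 0 ↔ s ∈ I := by
  refine ⟨I.ringCon.Quotient, { (inferInstance : Ring I.ringCon.Quotient) with mul_comm := ?_ },
    I.ringCon.mk', RingCon.mk'_surjective _, fun s => TwoSidedIdeal.ringCon_mk'_eq_zero_iff⟩
  intro a b
  obtain ⟨s, rfl⟩ := RingCon.mk'_surjective _ a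
  obtain ⟨t, rfl⟩ := RingCon.mk'_surjective _ b
  exact (RingCon.eq _).2 (h s t)

variable {A : Type*} [CommRing A] {π : R →+* A} {I : TwoSidedIdeal R}

theorem isDomain_of_tsiPrime (hπ : Function.Surjective π) (hI : ∀ s, π s = 0 ↔ s ∈ I)
    (h : tsiPrime I) : IsDomain A := by
  have : Nontrivial A := by
    refine ⟨0, 1, fun h1 => h.one_notMem ?_⟩
    rw [← hI, map_one, h1]
  have : NoZeroDivisors A := ⟨fun {a b} hab => by
    obtain ⟨s, rfl⟩ := hπ a
    obtain ⟨t, rfl⟩ := hπ b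
    rw [hI, hI]
    refine (tsiPrime_iff.1 h).2 s t fun r => ?_
    rw [← hI, map_mul, map_mul, mul_right_comm, hab, zero_mul]⟩
  exact NoZeroDivisors.to_isDomain _

/-- The image of a two-sided ideal under a surjective homomorphism to a commutative ring. -/
def mapIdeal (hπ : Function.Surjective π) (P : TwoSidedIdeal R) : Ideal A where
  carrier := π '' P
  add_mem' := by
    rintro _ _ ⟨a, ha, rfl⟩ ⟨b, hb, rfl⟩
    exact ⟨a + b, P.add_mem ha hb, map_add _ _ _⟩
  zero_mem' := ⟨0, P.zero_mem, map_zero _⟩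
  smul_mem' := by
    rintro c _ ⟨a, ha, rfl⟩
    obtain ⟨s, rfl⟩ := hπ c
    exact ⟨s * a, P.mul_mem_left _ _ ha, map_mul _ _ _⟩

theorem mem_mapIdeal {hπ : Function.Surjective π} {P : TwoSidedIdeal R} {z : A} :
    z ∈ mapIdeal hπ P ↔ ∃ a ∈ P, π a = z := Iff.rfl

theorem mapIdeal_eq_bot_iff {hπ : Function.Surjective π} (hI : ∀ s, π s = 0 ↔ s ∈ I)
    {P : TwoSidedIdeal R} : mapIdeal hπ P = ⊥ ↔ P ≤ I := by
  rw [Submodule.eq_bot_iff]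
  constructor
  · exact fun h a ha => (hI a).1 (h _ ⟨a, ha, rfl⟩)
  · rintro h _ ⟨a, ha, rfl⟩
    exact (hI a).2 (h ha)

theorem mapIdeal_ne_top {hπ : Function.Surjective π} (hI : ∀ s, π s = 0 ↔ s ∈ I)
    {P : TwoSidedIdeal R} (hP : (1 : R) ∉ P ⊔ I) : mapIdeal hπ P ≠ ⊤ := by
  intro h
  obtain ⟨p, hp, hp1⟩ := mem_mapIdeal.1 ((Ideal.eq_top_iff_one _).1 h)
  refine hP (TwoSidedIdeal.mem_sup.2 ⟨p, hp, 1 - p, ?_, add_sub_cancel p 1⟩)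
  rw [← hI, map_sub, hp1, map_one, sub_self]

theorem mem_comap_toTwoSided {J : Ideal A} {a : R} :
    a ∈ TwoSidedIdeal.comap π J.toTwoSided ↔ π a ∈ J := by
  rw [TwoSidedIdeal.mem_comap, Ideal.mem_toTwoSided]

theorem le_of_tsiMul_self [IsDomain A] [IsNoetherianRing A] (hπ : Function.Surjective π)
    (hI : ∀ s, π s = 0 ↔ s ∈ I) {P : TwoSidedIdeal R} (hP : (1 : R) ∉ P ⊔ I)
    (h : tsiMul P P = P) : P ≤ I := by
  rw [← mapIdeal_eq_bot_iff (hπ := hπ) hI]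
  refine ((Ideal.isIdempotentElem_iff_eq_bot_or_top _ (IsNoetherian.noetherian _)).1
    (le_antisymm Ideal.mul_le_left ?_)).resolve_right (mapIdeal_ne_top hI hP)
  have : P ≤ TwoSidedIdeal.comap π (mapIdeal hπ P * mapIdeal hπ P).toTwoSided := by
    conv_lhs => rw [← h]
    rw [tsiMul_le]
    intro a ha b hb
    rw [mem_comap_toTwoSided, map_mul]
    exact Ideal.mul_mem_mul ⟨a, ha, rfl⟩ ⟨b, hb, rfl⟩
  rintro _ ⟨a, ha, rfl⟩
  exact mem_comap_toTwoSided.1 (this ha)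

theorem isCoatom_comap (hπ : Function.Surjective π) (hI : ∀ s, π s = 0 ↔ s ∈ I)
    (hone : ∀ P : TwoSidedIdeal R, P ≠ ⊤ → (1 : R) ∉ P ⊔ I) {m : Ideal A} (hm : m.IsMaximal) :
    IsCoatom (TwoSidedIdeal.comap π m.toTwoSided) := by
  constructor
  · intro h
    refine hm.ne_top ((Ideal.eq_top_iff_one m).2 ?_)
    rw [← map_one π, ← mem_comap_toTwoSided, h]
    exact TwoSidedIdeal.mem_top _
  · intro Q hQ
    by_contra hQt
    obtain ⟨a, haQ, ha⟩ := SetLike.exists_of_lt hQ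
    refine mapIdeal_ne_top (hπ := hπ) hI (hone Q hQt)
      (hm.1.2 _ (lt_of_le_of_ne (fun z hz => ?_) fun h => ha ?_))
    · obtain ⟨s, rfl⟩ := hπ z
      exact ⟨s, hQ.le (mem_comap_toTwoSided.2 hz), rfl⟩
    · rw [mem_comap_toTwoSided, h]
      exact ⟨a, haQ, rfl⟩

theorem le_of_forall_isCoatom_le [IsDomain A] [IsJacobsonRing A] (hπ : Function.Surjective π)
    (hI : ∀ s, π s = 0 ↔ s ∈ I) (hone : ∀ P : TwoSidedIdeal R, P ≠ ⊤ → (1 : R) ∉ P ⊔ I)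
    {P : TwoSidedIdeal R} (h : ∀ M : TwoSidedIdeal R, IsCoatom M → P ≤ M) : P ≤ I := by
  have hjac : (⊥ : Ideal A).jacobson = ⊥ :=
    isJacobsonRing_iff.1 inferInstance _ (Ideal.isPrime_bot).isRadical
  rw [← mapIdeal_eq_bot_iff (hπ := hπ) hI, eq_bot_iff, ← hjac]
  rintro _ ⟨a, ha, rfl⟩
  rw [Ideal.jacobson, Ideal.mem_sInf]
  rintro m ⟨-, hm⟩
  exact mem_comap_toTwoSided.1 (h _ (isCoatom_comap hπ hI hone hm) ha)

end CommutativeQuotient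

theorem exists_mvPolynomial_surjective {A : Type*} [CommRing A] {π : SnAlg K n →+* A}
    (hπ : Function.Surjective π) :
    ∃ φ : MvPolynomial (Fin n ⊕ Fin n) K →+* A, Function.Surjective φ := by
  refine ⟨eval₂Hom (π.comp (algebraMap K (SnAlg K n)))
    (Sum.elim (fun i => π (xS K n i)) fun i => π (yS K n i)), fun a => ?_⟩
  obtain ⟨s, rfl⟩ := hπ a
  induction s using SnAlg.induction with
  | hx i => exact ⟨X (Sum.inl i), eval₂Hom_X' _ _ _⟩
  | hy i => exact ⟨X (Sum.inr i), eval₂Hom_X' _ _ _⟩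
  | halg c => exact ⟨C c, eval₂Hom_C _ _ _⟩
  | hadd s t hs ht =>
    obtain ⟨f, hf⟩ := hs
    obtain ⟨g, hg⟩ := ht
    exact ⟨f + g, by rw [map_add, map_add, hf, hg]⟩
  | hmul s t hs ht =>
    obtain ⟨f, hf⟩ := hs
    obtain ⟨g, hg⟩ := ht
    exact ⟨f * g, by rw [map_mul, map_mul, hf, hg]⟩

theorem exists_commRing_quotient_aIdeal (K : Type u) [Field K] (n : ℕ) :
    ∃ (A : Type u) (_ : CommRing A) (π : SnAlg K n →+* A),
      Function.Surjective π ∧ ∀ s, π s = 0 ↔ s ∈ aIdeal K n := by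
  have he (i : Fin n) : (aIdeal K n).ringCon.mk' (eS K i) = 0 := by
    rw [TwoSidedIdeal.ringCon_mk'_eq_zero_iff, aIdeal_eq]
    exact eS_mem_pNIdeal_iff.2 (Finset.mem_univ i)
  have hmul (s t : SnAlg K n) :
      (aIdeal K n).ringCon.mk' (s * t) = (aIdeal K n).ringCon.mk' (t * s) := by
    rw [map_mul, map_mul]
    exact commute_map_of_forall he s t
  exact exists_commRing_of_ringCon_mul_comm _ fun s t => (RingCon.eq _).1 (hmul s t)

theorem one_notMem_sup_aIdeal {P : TwoSidedIdeal (SnAlg K n)} (hP : P ≠ ⊤) :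
    (1 : SnAlg K n) ∉ P ⊔ aIdeal K n := by
  intro h
  obtain ⟨p, hp, q, hq, hpq⟩ := TwoSidedIdeal.mem_sup.1 h
  rw [aIdeal_eq] at hq
  obtain ⟨k, hk⟩ := mem_pNIdeal_iff.1 hq
  obtain ⟨s, hs⟩ := exists_mul_mulS_eq_one (K := K) (Finset.univ : Finset (Fin n)) k
  have h1 : p * mulS K n (prodX K Finset.univ ^ k) = mulS K n (prodX K Finset.univ ^ k) := by
    rw [← add_zero (p * _), ← hk, ← add_mul, hpq, one_mul]
  refine hP ((TwoSidedIdeal.one_mem_iff P).1 ?_)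
  rw [← hs, ← h1]
  exact P.mul_mem_left _ _ (P.mul_mem_right _ _ hp)

theorem aIdeal_le_of_isCoatom {M : TwoSidedIdeal (SnAlg K n)} (hM : IsCoatom M) :
    aIdeal K n ≤ M := by
  by_contra h
  have htop := hM.2 (M ⊔ aIdeal K n)
    (lt_of_le_of_ne le_sup_left fun h' => h (sup_eq_left.1 h'.symm))
  exact one_notMem_sup_aIdeal hM.1 (htop ▸ TwoSidedIdeal.mem_top _)

theorem le_aIdeal_of_tsiMul_self {P : TwoSidedIdeal (SnAlg K n)} (hP : P ≠ ⊤)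
    (h : tsiMul P P = P) : P ≤ aIdeal K n := by
  obtain ⟨A, _, π, hπ, hI⟩ := exists_commRing_quotient_aIdeal K n
  have : IsDomain A := isDomain_of_tsiPrime hπ hI (aIdeal_eq (K := K) ▸ tsiPrime_pNIdeal _)
  obtain ⟨φ, hφ⟩ := exists_mvPolynomial_surjective hπ
  have : IsNoetherianRing A := isNoetherianRing_of_surjective _ _ φ hφ
  exact le_of_tsiMul_self hπ hI (one_notMem_sup_aIdeal hP) h

theorem le_aIdeal_of_forall_isCoatom_le {P : TwoSidedIdeal (SnAlg K n)}
    (h : ∀ M : TwoSidedIdeal (SnAlg K n), IsCoatom M → P ≤ M) : P ≤ aIdeal K n := by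
  obtain ⟨A, _, π, hπ, hI⟩ := exists_commRing_quotient_aIdeal K n
  have : IsDomain A := isDomain_of_tsiPrime hπ hI (aIdeal_eq (K := K) ▸ tsiPrime_pNIdeal _)
  have : IsJacobsonRing A := isJacobsonRing_of_surjective (exists_mvPolynomial_surjective hπ)
  exact le_of_forall_isCoatom_le hπ hI (fun _ => one_notMem_sup_aIdeal) h

theorem tsiMul_self_eq_iff_exists {P : TwoSidedIdeal (SnAlg K n)} (hP : tsiPrime P) :
    tsiMul P P = P ↔ ∃ N, P = pNIdeal K n N := by
  refine ⟨fun h => eq_pNIdeal_of_le_aIdeal hP (le_aIdeal_of_tsiMul_self hP.1 h), ?_⟩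
  rintro ⟨N, rfl⟩
  exact tsiMul_pNIdeal_self N

theorem forall_isCoatom_le_iff_exists {P : TwoSidedIdeal (SnAlg K n)} (hP : tsiPrime P) :
    (∀ M : TwoSidedIdeal (SnAlg K n), IsCoatom M → P ≤ M) ↔ ∃ N, P = pNIdeal K n N := by
  refine ⟨fun h => eq_pNIdeal_of_le_aIdeal hP (le_aIdeal_of_forall_isCoatom_le h), ?_⟩
  rintro ⟨N, rfl⟩ M hM
  exact (pNIdeal_le_aIdeal N).trans (aIdeal_le_of_isCoatom hM)

theorem ncard_tsiPrime_idempotent (K : Type*) [Field K] (n : ℕ) :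
    Set.ncard {P : TwoSidedIdeal (SnAlg K n) | tsiPrime P ∧ tsiMul P P = P} = 2 ^ n := by
  have : {P : TwoSidedIdeal (SnAlg K n) | tsiPrime P ∧ tsiMul P P = P} =
      Set.range (pNIdeal K n) := by
    ext P
    constructor
    · rintro ⟨hP, h⟩
      obtain ⟨N, rfl⟩ := (tsiMul_self_eq_iff_exists hP).1 h
      exact ⟨N, rfl⟩
    · rintro ⟨N, rfl⟩
      exact ⟨tsiPrime_pNIdeal N, tsiMul_pNIdeal_self N⟩
  rw [this, Set.ncard_range_of_injective pNIdeal_injective, Nat.card_eq_fintype_card,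
    Fintype.card_finset, Fintype.card_fin]

/-- the primes of `S_n` contained in `a_n` are exactly the `2^n` pairwise
distinct ideals `p_N`, each `p_N` is idempotent of height `|N|`, and for a prime `P` the
conditions `P² = P`, `P` lies in every maximal two-sided ideal, and `P = p_N` for some `N`,
are all equivalent; in particular `S_n` has exactly `2^n` idempotent prime ideals. -/
theorem statement18 (K : Type u) [Field K] (n : ℕ) (hn : 0 < n) :
    (∀ P : TwoSidedIdeal (SnAlg K n),
      (tsiPrime P ∧ P ≤ aIdeal K n) ↔ ∃ N : Finset (Fin n), P = pNIdeal K n N) ∧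
    Function.Injective (pNIdeal K n) ∧
    (∀ N : Finset (Fin n),
      tsiMul (pNIdeal K n N) (pNIdeal K n N) = pNIdeal K n N ∧
      heightIs (pNIdeal K n N) N.card) ∧
    (∀ P : TwoSidedIdeal (SnAlg K n), tsiPrime P →
      ((tsiMul P P = P ↔ ∀ M : TwoSidedIdeal (SnAlg K n), IsCoatom M → P ≤ M) ∧
       (tsiMul P P = P ↔ ∃ N : Finset (Fin n), P = pNIdeal K n N))) ∧
    Set.ncard {P : TwoSidedIdeal (SnAlg K n) | tsiPrime P ∧ tsiMul P P = P} = 2 ^ n := by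
  exact ⟨fun _ => tsiPrime_and_le_aIdeal_iff, pNIdeal_injective,
    fun N => ⟨tsiMul_pNIdeal_self N, heightIs_pNIdeal N⟩,
    fun _ hP => ⟨(tsiMul_self_eq_iff_exists hP).trans (forall_isCoatom_le_iff_exists hP).symm,
      tsiMul_self_eq_iff_exists hP⟩,
    ncard_tsiPrime_idempotent K n⟩
end
end

section
/- For a subset X of {1, …, n} let q_X := ∏_{i ∉ X} p_i (with q_{{1,…,n}} := S_n). Call a set C of subsets of {1, …, n} an antichain if its elements are pairwise incomparable under inclusion. Then the map C ↦ Σ_{X ∈ C} q_X (sending the empty antichain to the zero ideal) is a bijection from the set of antichains of subsets of {1, …, n} onto the set of idempotent two-sided ideals of S_n; in particular the number of idempotent ideals of S_n is finite and equals the Dedekind number d_n, the number of antichains of subsets of an n-element set. -/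
set_option synthInstance.maxHeartbeats 1000000
set_option maxHeartbeats 1000000

open MvPolynomial

noncomputable section

/-- The ideal `q_X = ∏_{i ∉ X} p_i` of `S_n` for a subset `X` of `{1, …, n}`
(with `q_{{1,…,n}} = S_n`). -/
def qIdeal (K : Type u) [Field K] (n : ℕ) (X : Finset (Fin n)) : TwoSidedIdeal (SnAlg K n) :=
  ((Xᶜ : Finset (Fin n)).sort (· ≤ ·)).foldr (fun i J => tsiMul (pIdeal K n i) J) ⊤

/-- The ideal `Σ_{X ∈ C} q_X` associated to a collection `C` of subsets of `{1, …, n}`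
(the empty collection gives the zero ideal). -/
def antichainIdeal (K : Type u) [Field K] (n : ℕ) (C : Finset (Finset (Fin n))) :
    TwoSidedIdeal (SnAlg K n) :=
  ⨆ X ∈ C, qIdeal K n X

namespace OneSided

/-- The operator `x^α e_Y y^β`, where `e_Y = ∏_{i ∈ Y} (1 - x_i y_i)`. -/
def opE (K : Type u) [Field K] (n : ℕ) (α : Fin n →₀ ℕ) (Y : Finset (Fin n)) (β : Fin n →₀ ℕ) :
    Module.End K (PolyAlg K n) :=
  (basisMonomials (Fin n) K).constr K fun δ =>
    if β ≤ δ ∧ ∀ i ∈ Y, δ i = β i then monomial (δ - β + α) (1 : K) else 0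

variable {K : Type u} [Field K] {n : ℕ}

lemma opE_monomial (α : Fin n →₀ ℕ) (Y : Finset (Fin n)) (β δ : Fin n →₀ ℕ) :
    opE K n α Y β (monomial δ 1) =
      if β ≤ δ ∧ ∀ i ∈ Y, δ i = β i then monomial (δ - β + α) (1 : K) else 0 := by
  have := (basisMonomials (Fin n) K).constr_basis K (fun δ =>
    if β ≤ δ ∧ ∀ i ∈ Y, δ i = β i then monomial (δ - β + α) (1 : K) else 0) δ
  rwa [coe_basisMonomials] at this

lemma end_ext {f g : Module.End K (PolyAlg K n)}
    (h : ∀ δ, f (monomial δ 1) = g (monomial δ 1)) : f = g := by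
  refine (basisMonomials (Fin n) K).ext fun δ => ?_
  simpa using h δ

lemma Yop_monomial (i : Fin n) (δ : Fin n →₀ ℕ) :
    Yop K n i (monomial δ 1) =
      if δ i = 0 then 0 else monomial (δ - Finsupp.single i 1) (1 : K) := by
  have := (basisMonomials (Fin n) K).constr_basis K (fun δ =>
    if δ i = 0 then 0 else monomial (δ - Finsupp.single i 1) (1 : K)) δ
  rwa [coe_basisMonomials] at this

lemma Xop_eq (i : Fin n) : Xop K n i = opE K n (Finsupp.single i 1) ∅ 0 := by
  refine end_ext fun δ => ?_
  rw [opE_monomial, if_pos (by simp)]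
  simp [Xop, X, monomial_mul, add_comm]

lemma Yop_eq (i : Fin n) : Yop K n i = opE K n 0 ∅ (Finsupp.single i 1) := by
  refine end_ext fun δ => ?_
  rw [opE_monomial, Yop_monomial]
  by_cases h : δ i = 0 <;> simp [h, Nat.one_le_iff_ne_zero]

lemma opE_one : opE K n 0 ∅ 0 = 1 := by
  refine end_ext fun δ => ?_
  rw [opE_monomial, if_pos (by simp)]
  simp

lemma opE_mul (α β α' β' : Fin n →₀ ℕ) (Y Y' : Finset (Fin n)) :
    opE K n α Y β * opE K n α' Y' β' =
      if (∀ i ∈ Y, α' i ≤ β i) ∧ (∀ i ∈ Y', β i ≤ α' i) then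
        opE K n (α + (α' - β)) (Y ∪ Y') (β' + (β - α')) else 0 := by
  refine end_ext fun δ => ?_
  rw [Module.End.mul_apply, opE_monomial]
  by_cases h1 : β' ≤ δ ∧ ∀ i ∈ Y', δ i = β' i
  · rw [if_pos h1, opE_monomial]
    obtain ⟨h1, h1'⟩ := h1
    by_cases h2 : β ≤ δ - β' + α' ∧ ∀ i ∈ Y, (δ - β' + α') i = β i
    · rw [if_pos h2]
      obtain ⟨h2, h2'⟩ := h2
      simp only [Finsupp.le_def, Finsupp.coe_add, Finsupp.coe_tsub, Pi.add_apply, Pi.sub_apply] at *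
      rw [if_pos, opE_monomial, if_pos]
      · congr 2
        ext i
        have := h1 i; have := h2 i
        simp only [Finsupp.coe_add, Finsupp.coe_tsub, Pi.add_apply, Pi.sub_apply]
        omega
      · refine ⟨fun i => ?_, fun i hi => ?_⟩
        · have := h1 i; have := h2 i
          simp only [Finsupp.coe_add, Finsupp.coe_tsub, Pi.add_apply, Pi.sub_apply]
          omega
        · have := h1 i; have := h2 i
          simp only [Finsupp.coe_add, Finsupp.coe_tsub, Pi.add_apply, Pi.sub_apply]
          rcases Finset.mem_union.1 hi with hi | hi
          · have := h2' i hi; omega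
          · have := h1' i hi; omega
      · refine ⟨fun i hi => ?_, fun i hi => ?_⟩
        · have := h2' i hi; omega
        · have := h1' i hi; have := h2 i; omega
    · rw [if_neg h2]
      split_ifs with h3
      · rw [opE_monomial, if_neg]
        rintro ⟨h4, h5⟩
        refine h2 ⟨fun i => ?_, fun i hi => ?_⟩
        · have := h1 i; have := h4 i
          simp only [Finsupp.coe_add, Finsupp.coe_tsub, Pi.add_apply, Pi.sub_apply] at *
          omega
        · have := h5 i (Finset.mem_union_left _ hi); have := h1 i; have := h3.1 i hi
          simp only [Finsupp.coe_add, Finsupp.coe_tsub, Pi.add_apply, Pi.sub_apply] at *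
          omega
      · simp
  · rw [if_neg h1, map_zero]
    split_ifs with h3
    · rw [opE_monomial, if_neg]
      rintro ⟨h4, h5⟩
      refine h1 ⟨fun i => ?_, fun i hi => ?_⟩
      · have := h4 i
        simp only [Finsupp.coe_add, Finsupp.coe_tsub, Pi.add_apply, Pi.sub_apply] at *
        omega
      · have := h5 i (Finset.mem_union_right _ hi); have := h3.2 i hi
        simp only [Finsupp.coe_add, Finsupp.coe_tsub, Pi.add_apply, Pi.sub_apply] at *
        omega
    · simp

lemma opE_insert (α β : Fin n →₀ ℕ) {Y : Finset (Fin n)} {i : Fin n} (hi : i ∉ Y) :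
    opE K n α (insert i Y) β = opE K n α Y β -
      opE K n (α + Finsupp.single i 1) Y (β + Finsupp.single i 1) := by
  refine end_ext fun δ => ?_
  rw [LinearMap.sub_apply, opE_monomial, opE_monomial, opE_monomial]
  by_cases h1 : β ≤ δ ∧ ∀ i ∈ Y, δ i = β i
  · rw [if_pos h1]
    by_cases h2 : δ i = β i
    · rw [if_pos, if_neg, sub_zero]
      · rintro ⟨h3, -⟩
        have := h3 i
        simp at this; omega
      · exact ⟨h1.1, by simpa [h2] using h1.2⟩
    · have hlt : β i + 1 ≤ δ i := by have := h1.1 i; omega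
      have key : ∀ j, (β + (Finsupp.single i 1 : Fin n →₀ ℕ)) j ≤ δ j := fun j => by
        by_cases hj : i = j
        · subst hj; simpa using hlt
        · simpa [Finsupp.single_apply, hj] using h1.1 j
      rw [if_neg, if_pos]
      · rw [eq_comm, sub_eq_zero]
        congr 2
        ext j
        have := key j
        simp only [Finsupp.coe_add, Finsupp.coe_tsub, Pi.add_apply, Pi.sub_apply] at *
        omega
      · refine ⟨key, fun j hj => ?_⟩
        have : i ≠ j := by rintro rfl; exact hi hj
        simpa [Finsupp.single_apply, this] using h1.2 j hj
      · rintro ⟨-, h⟩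
        exact h2 (h i (Finset.mem_insert_self _ _))
  · rw [if_neg h1, if_neg, if_neg, sub_zero]
    · rintro ⟨h3, h4⟩
      refine h1 ⟨le_trans le_self_add h3, fun j hj => ?_⟩
      have : i ≠ j := by rintro rfl; exact hi hj
      simpa [Finsupp.single_apply, this] using h4 j hj
    · rintro ⟨h3, h4⟩
      exact h1 ⟨h3, fun j hj => h4 j (Finset.mem_insert_of_mem hj)⟩

lemma opE_left_mem (α : Fin n →₀ ℕ) : opE K n α ∅ 0 ∈ SnAlg K n := by
  induction α using Finsupp.induction_linear with
  | zero => rw [opE_one]; exact one_mem _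
  | add α β hα hβ =>
    have := mul_mem hα hβ
    rwa [opE_mul, if_pos (by simp), tsub_zero, Finset.union_self, zero_tsub, add_zero] at this
  | single i k =>
    induction k with
    | zero => rw [Finsupp.single_zero, opE_one]; exact one_mem _
    | succ k ih =>
      have := mul_mem ih (xS K n i).2
      simp only [xS] at this
      rwa [Xop_eq, opE_mul, if_pos (by simp), tsub_zero, Finset.union_self, zero_tsub, add_zero,
        ← Finsupp.single_add] at this

lemma opE_right_mem (β : Fin n →₀ ℕ) : opE K n 0 ∅ β ∈ SnAlg K n := by
  induction β using Finsupp.induction_linear with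
  | zero => rw [opE_one]; exact one_mem _
  | add α β hα hβ =>
    have := mul_mem hβ hα
    rwa [opE_mul, if_pos (by simp), tsub_zero, Finset.union_self, zero_tsub, add_zero] at this
  | single i k =>
    induction k with
    | zero => rw [Finsupp.single_zero, opE_one]; exact one_mem _
    | succ k ih =>
      have := mul_mem (yS K n i).2 ih
      simp only [yS] at this
      rwa [Yop_eq, opE_mul, if_pos (by simp), tsub_zero, Finset.union_self, zero_tsub, add_zero,
        ← Finsupp.single_add] at this

lemma opE_mem (α : Fin n →₀ ℕ) (Y : Finset (Fin n)) (β : Fin n →₀ ℕ) :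
    opE K n α Y β ∈ SnAlg K n := by
  induction Y using Finset.induction_on generalizing α β with
  | empty =>
    have := mul_mem (opE_left_mem (K := K) α) (opE_right_mem (K := K) β)
    rwa [opE_mul, if_pos (by simp), tsub_zero, Finset.union_self, add_zero, add_zero] at this
  | insert i Y hi ih => rw [opE_insert α β hi]; exact sub_mem (ih _ _) (ih _ _)

/-- `x^α e_Y y^β` as an element of `S_n`. -/
def op (K : Type u) [Field K] (n : ℕ) (α : Fin n →₀ ℕ) (Y : Finset (Fin n)) (β : Fin n →₀ ℕ) :
    SnAlg K n := ⟨opE K n α Y β, opE_mem α Y β⟩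

lemma xS_eq (i : Fin n) : xS K n i = op K n (Finsupp.single i 1) ∅ 0 := Subtype.ext (Xop_eq i)

lemma yS_eq (i : Fin n) : yS K n i = op K n 0 ∅ (Finsupp.single i 1) := Subtype.ext (Yop_eq i)

lemma op_one : op K n 0 ∅ 0 = 1 := Subtype.ext opE_one

lemma op_mul (α β α' β' : Fin n →₀ ℕ) (Y Y' : Finset (Fin n)) :
    op K n α Y β * op K n α' Y' β' =
      if (∀ i ∈ Y, α' i ≤ β i) ∧ (∀ i ∈ Y', β i ≤ α' i) then
        op K n (α + (α' - β)) (Y ∪ Y') (β' + (β - α')) else 0 := by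
  refine Subtype.ext ((opE_mul α β α' β' Y Y').trans ?_)
  split_ifs <;> rfl

lemma op_mul_of {α β α' β' : Fin n →₀ ℕ} {Y Y' : Finset (Fin n)}
    (h : ∀ i ∈ Y, α' i ≤ β i) (h' : ∀ i ∈ Y', β i ≤ α' i) :
    op K n α Y β * op K n α' Y' β' = op K n (α + (α' - β)) (Y ∪ Y') (β' + (β - α')) := by
  rw [op_mul, if_pos ⟨h, h'⟩]

lemma op_insert_add (α β : Fin n →₀ ℕ) {Y : Finset (Fin n)} {i : Fin n} (hi : i ∉ Y) :
    op K n α (insert i Y) β + op K n (α + Finsupp.single i 1) Y (β + Finsupp.single i 1) =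
      op K n α Y β := by
  refine Subtype.ext ?_
  change opE K n α (insert i Y) β +
    opE K n (α + Finsupp.single i 1) Y (β + Finsupp.single i 1) = opE K n α Y β
  rw [opE_insert α β hi, sub_add_cancel]

lemma one_sub_xS_mul_yS (i : Fin n) : 1 - xS K n i * yS K n i = op K n 0 {i} 0 := by
  refine Subtype.ext ?_
  change (1 : Module.End K (PolyAlg K n)) - Xop K n i * Yop K n i = opE K n 0 {i} 0
  rw [Xop_eq, Yop_eq, opE_mul, if_pos (by simp), ← insert_empty_eq i,
    opE_insert _ _ (Finset.notMem_empty i), opE_one]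
  simp

/-- The normally ordered monomials `x^α y^β` span `S_n`. -/
lemma span_op_eq_top :
    Submodule.span K (Set.range fun p : (Fin n →₀ ℕ) × (Fin n →₀ ℕ) => op K n p.1 ∅ p.2) = ⊤ := by
  set M := Submodule.span K
    (Set.range fun p : (Fin n →₀ ℕ) × (Fin n →₀ ℕ) => op K n p.1 ∅ p.2) with hM
  have mem : ∀ α β, op K n α ∅ β ∈ M := fun α β => Submodule.subset_span ⟨(α, β), rfl⟩
  have mul : ∀ a ∈ M, ∀ b ∈ M, a * b ∈ M := by
    intro a ha b hb
    refine Submodule.span_induction₂ (p := fun a b _ _ => a * b ∈ M) ?_ ?_ ?_ ?_ ?_ ?_ ?_ ha hb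
    · rintro _ _ ⟨p, rfl⟩ ⟨q, rfl⟩
      simp only
      rw [op_mul_of (by simp) (by simp), Finset.union_self]
      exact mem _ _
    · intro y _; rw [zero_mul]; exact M.zero_mem
    · intro y _; rw [mul_zero]; exact M.zero_mem
    · intro x y z _ _ _ h1 h2; rw [add_mul]; exact M.add_mem h1 h2
    · intro x y z _ _ _ h1 h2; rw [mul_add]; exact M.add_mem h1 h2
    · intro r x y _ _ h; rw [smul_mul_assoc]; exact M.smul_mem _ h
    · intro r x y _ _ h; rw [mul_smul_comm]; exact M.smul_mem _ h
  rw [eq_top_iff]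
  rintro ⟨a, ha⟩ -
  refine Algebra.adjoin_induction (p := fun x hx => (⟨x, hx⟩ : SnAlg K n) ∈ M) ?_ ?_ ?_ ?_ ha
  · rintro x (⟨i, rfl⟩ | ⟨i, rfl⟩)
    · change xS K n i ∈ M
      rw [xS_eq]; exact mem _ _
    · change yS K n i ∈ M
      rw [yS_eq]; exact mem _ _
  · intro r
    have := M.smul_mem r (op_one (K := K) (n := n) ▸ mem 0 0)
    rwa [← Algebra.algebraMap_eq_smul_one] at this
  · intro x y hx hy h1 h2; exact M.add_mem h1 h2
  · intro x y hx hy h1 h2; exact mul _ h1 _ h2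

lemma linearIndependent_opE :
    LinearIndependent K fun p : (Fin n →₀ ℕ) × (Fin n →₀ ℕ) => opE K n p.1 ∅ p.2 := by
  rw [linearIndependent_iff]
  intro l hl
  by_contra hne
  obtain ⟨β, hβ⟩ := (l.support.image Prod.snd).exists_minimal
    (by simpa [Finset.image_nonempty, Finsupp.support_nonempty_iff] using hne)
  obtain ⟨⟨α, β'⟩, hp, rfl⟩ := Finset.mem_image.1 hβ.1
  have h1 := congrArg (fun a : Module.End K (PolyAlg K n) => coeff α (a (monomial β' 1))) hl
  rw [Finsupp.linearCombination_apply, Finsupp.sum] at h1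
  simp only [LinearMap.sum_apply, coeff_sum] at h1
  rw [Finset.sum_eq_single (α, β')] at h1
  · simp [opE_monomial] at h1
    exact (Finsupp.mem_support_iff.1 hp) h1
  · rintro ⟨α₁, β₁⟩ hq hne
    by_cases hle : β₁ ≤ β'
    · have := hβ.eq_of_le (Finset.mem_image_of_mem _ hq) hle
      simp only at this
      subst this
      have : α₁ ≠ α := by rintro rfl; exact hne rfl
      simp [opE_monomial, coeff_monomial, this]
    · simp [opE_monomial, hle]
  · exact fun h => (h hp).elim

lemma linearIndependent_op :
    LinearIndependent K fun p : (Fin n →₀ ℕ) × (Fin n →₀ ℕ) => op K n p.1 ∅ p.2 :=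
  LinearIndependent.of_comp (SnAlg K n).val.toLinearMap linearIndependent_opE

/-- The basis of `S_n` formed by the normally ordered monomials. -/
def opBasis (K : Type u) [Field K] (n : ℕ) :
    Module.Basis ((Fin n →₀ ℕ) × (Fin n →₀ ℕ)) K (SnAlg K n) :=
  Module.Basis.mk linearIndependent_op span_op_eq_top.ge

lemma opBasis_apply (p : (Fin n →₀ ℕ) × (Fin n →₀ ℕ)) : opBasis K n p = op K n p.1 ∅ p.2 :=
  Module.Basis.mk_apply _ _ _

@[elab_as_elim]
lemma op_induction {P : SnAlg K n → Prop} (a : SnAlg K n) (hop : ∀ α β, P (op K n α ∅ β))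
    (zero : P 0) (add : ∀ a b, P a → P b → P (a + b)) (smul : ∀ (c : K) a, P a → P (c • a)) :
    P a := by
  have : a ∈ Submodule.span K
      (Set.range fun p : (Fin n →₀ ℕ) × (Fin n →₀ ℕ) => op K n p.1 ∅ p.2) := by
    rw [span_op_eq_top]; trivial
  induction this using Submodule.span_induction with
  | mem x h => obtain ⟨p, rfl⟩ := h; exact hop _ _
  | zero => exact zero
  | add x y _ _ h1 h2 => exact add _ _ h1 h2
  | smul c x _ h => exact smul _ _ h

lemma map_mem_of_mem_span {R M : Type*} [Ring R] [AddCommGroup M] (f : R →+ M) (J : AddSubgroup M)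
    {s : Set R} (h : ∀ x ∈ s, ∀ u v, f (u * x * v) ∈ J) {x : R} (hx : x ∈ TwoSidedIdeal.span s) :
    f x ∈ J := by
  suffices h : ∀ u v, f (u * x * v) ∈ J by simpa using h 1 1
  refine TwoSidedIdeal.span_induction (p := fun x _ => ∀ u v, f (u * x * v) ∈ J)
    h ?_ ?_ ?_ ?_ ?_ hx
  · simp
  · intro x y _ _ hx hy u v
    rw [mul_add, add_mul, map_add]
    exact add_mem (hx u v) (hy u v)
  · intro x _ hx u v
    rw [mul_neg, neg_mul, map_neg]
    exact neg_mem (hx u v)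
  · intro r x _ hx u v
    rw [← mul_assoc]
    exact hx _ v
  · intro r x _ hx u v
    rw [← mul_assoc, mul_assoc _ r v]
    exact hx u _

/-- The exponent `α - β`, restricted to the coordinates in `X`. -/
def relDeg (X : Finset (Fin n)) (α β : Fin n →₀ ℕ) : X → ℤ := fun i => (α i : ℤ) - β i

/-- The ring of Laurent polynomials in the variables indexed by `X`. -/
abbrev Laurent (K : Type u) [Field K] {n : ℕ} (X : Finset (Fin n)) : Type u :=
  AddMonoidAlgebra K (X → ℤ)

/-- The `(0, 0)` matrix entry, in the directions outside `X`, of the image of an element of `S_n`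
modulo the ideals `p_i`, `i ∈ X`. -/
def symb (K : Type u) [Field K] {n : ℕ} (X : Finset (Fin n)) : SnAlg K n →ₗ[K] Laurent K X :=
  (opBasis K n).constr K fun p =>
    if ∀ i ∉ X, p.1 i = 0 ∧ p.2 i = 0 then AddMonoidAlgebra.single (relDeg X p.1 p.2) 1 else 0

lemma symb_op_empty (X : Finset (Fin n)) (α β : Fin n →₀ ℕ) :
    symb K X (op K n α ∅ β) = if ∀ i ∉ X, α i = 0 ∧ β i = 0 then
      AddMonoidAlgebra.single (relDeg X α β) 1 else 0 := by
  have := (opBasis K n).constr_basis K (fun p : (Fin n →₀ ℕ) × (Fin n →₀ ℕ) =>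
    if ∀ i ∉ X, p.1 i = 0 ∧ p.2 i = 0 then
      (AddMonoidAlgebra.single (relDeg X p.1 p.2) 1 : Laurent K X) else 0) (α, β)
  rwa [opBasis_apply] at this

lemma symb_op (X : Finset (Fin n)) (α : Fin n →₀ ℕ) (Y : Finset (Fin n)) (β : Fin n →₀ ℕ) :
    symb K X (op K n α Y β) = if Disjoint Y X ∧ ∀ i ∉ X, α i = 0 ∧ β i = 0 then
      AddMonoidAlgebra.single (relDeg X α β) 1 else 0 := by
  induction Y using Finset.induction_on generalizing α β with
  | empty => simp [symb_op_empty]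
  | insert i Y hi ih =>
    have key := congrArg (symb K X) (op_insert_add (K := K) α β hi)
    rw [map_add, ih, ih] at key
    rw [eq_sub_of_add_eq key]
    by_cases hX : i ∈ X
    · rw [if_neg (c := Disjoint (insert i Y) X ∧ _) (by simp [hX]), sub_eq_zero]
      have h1 : relDeg X (α + Finsupp.single i 1) (β + Finsupp.single i 1) = relDeg X α β := by
        ext j; simp [relDeg]
      rw [h1]
      congr 1
      have : ∀ j ∉ X, (Finsupp.single i 1 : Fin n →₀ ℕ) j = 0 := fun j hj =>
        Finsupp.single_eq_of_ne (by rintro rfl; exact hj hX)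
      refine propext (and_congr_right fun _ => forall₂_congr fun j hj => ?_)
      simp [this j hj]
    · have h : ¬ (Disjoint Y X ∧ ∀ j ∉ X, (α + Finsupp.single i 1 : Fin n →₀ ℕ) j = 0 ∧
          (β + Finsupp.single i 1 : Fin n →₀ ℕ) j = 0) := by
        rintro ⟨-, h⟩
        simpa using (h i hX).1
      rw [if_neg h, sub_zero]
      simp [hX]

lemma symb_mul_op_mul_eq_zero {X Y : Finset (Fin n)} (h : ¬ Disjoint Y X) (u v : SnAlg K n) :
    symb K X (u * op K n 0 Y 0 * v) = 0 := by
  induction u using op_induction with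
  | zero => simp
  | add a b ha hb => rw [add_mul, add_mul, map_add, ha, hb, add_zero]
  | smul c a ha => rw [smul_mul_assoc, smul_mul_assoc, map_smul, ha, smul_zero]
  | hop α β =>
    induction v using op_induction with
    | zero => simp
    | add a b ha hb => rw [mul_add, map_add, ha, hb, add_zero]
    | smul c a ha => rw [mul_smul_comm, map_smul, ha, smul_zero]
    | hop α' β' =>
      rw [op_mul]
      split_ifs
      · rw [op_mul]
        split_ifs
        · rw [symb_op, if_neg]
          simpa using fun h' => (h h').elim
        · simp
      · simp

lemma symb_op_mul {X : Finset (Fin n)} {α β : Fin n →₀ ℕ} (h : ∀ i ∉ X, α i = 0 ∧ β i = 0)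
    (a : SnAlg K n) :
    symb K X (op K n α ∅ β * a) = AddMonoidAlgebra.single (relDeg X α β) 1 * symb K X a := by
  induction a using op_induction with
  | zero => simp
  | add a b ha hb => rw [mul_add, map_add, ha, hb, map_add, mul_add]
  | smul c a ha => rw [mul_smul_comm, map_smul, ha, map_smul, mul_smul_comm]
  | hop α' β' =>
    rw [op_mul_of (by simp) (by simp), Finset.union_self, symb_op_empty, symb_op_empty, mul_ite,
      mul_zero, AddMonoidAlgebra.single_mul_single, mul_one]
    have h1 : relDeg X (α + (α' - β)) (β' + (β - α')) = relDeg X α β + relDeg X α' β' := by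
      ext j
      simp only [relDeg, Finsupp.coe_add, Finsupp.coe_tsub, Pi.add_apply, Pi.sub_apply]
      omega
    rw [h1]
    congr 1
    refine propext (forall₂_congr fun j hj => ?_)
    simp [h j hj]

/-- The part of an exponent vector outside `X`. -/
def outside (X : Finset (Fin n)) (α : Fin n →₀ ℕ) : Fin n →₀ ℕ := α.filter (· ∉ X)

lemma outside_of_mem {X : Finset (Fin n)} (α : Fin n →₀ ℕ) {i : Fin n} (h : i ∈ X) :
    outside X α i = 0 := Finsupp.filter_apply_neg _ _ (by simpa using h)

lemma outside_of_notMem {X : Finset (Fin n)} (α : Fin n →₀ ℕ) {i : Fin n} (h : i ∉ X) :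
    outside X α i = α i := Finsupp.filter_apply_pos _ _ h

lemma symb_mul_op (X : Finset (Fin n)) (a : SnAlg K n) (α β : Fin n →₀ ℕ) :
    symb K X (a * op K n α ∅ β) = symb K X (a * op K n (outside X α) ∅ 0) *
      symb K X (op K n 0 ∅ (outside X α) * op K n α ∅ β) := by
  induction a using op_induction with
  | zero => simp
  | add a b ha hb => rw [add_mul, map_add, ha, hb, add_mul, map_add, add_mul]
  | smul c a ha => rw [smul_mul_assoc, map_smul, ha, smul_mul_assoc, map_smul, smul_mul_assoc]
  | hop α' β' =>
    simp only [op_mul, Finset.notMem_empty, false_imp_iff, implies_true, and_self, if_true,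
      Finset.union_self, symb_op_empty]
    rw [ite_mul, zero_mul, mul_ite, mul_zero, AddMonoidAlgebra.single_mul_single, mul_one, ← ite_and]
    have h1 : relDeg X (α' + (outside X α - β')) (0 + (β' - outside X α)) +
        relDeg X (0 + (α - outside X α)) (β + (outside X α - α)) =
          relDeg X (α' + (α - β')) (β + (β' - α)) := by
      ext j
      have := outside_of_mem α j.2
      simp only [relDeg, Finsupp.coe_add, Finsupp.coe_tsub, Pi.add_apply, Pi.sub_apply, this,
        Finsupp.coe_zero, Pi.zero_apply]
      omega
    rw [h1]
    congr 1
    rw [← forall₂_and]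
    refine propext (forall₂_congr fun j hj => ?_)
    have := outside_of_notMem α hj
    simp only [Finsupp.coe_add, Finsupp.coe_tsub, Pi.add_apply, Pi.sub_apply, this,
        Finsupp.coe_zero, Pi.zero_apply]
    omega

lemma symb_op_mul_op_eq_zero {X : Finset (Fin n)} {γ α : Fin n →₀ ℕ} (β : Fin n →₀ ℕ)
    (hγ : ∀ i ∈ X, γ i = 0) (h : γ ≠ outside X α) :
    symb K X (op K n 0 ∅ γ * op K n α ∅ β) = 0 := by
  rw [op_mul_of (by simp) (by simp), Finset.union_self, symb_op_empty, if_neg]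
  refine fun h' => h (Finsupp.ext fun i => ?_)
  by_cases hi : i ∈ X
  · rw [outside_of_mem α hi, hγ i hi]
  · have := h' i hi
    rw [outside_of_notMem α hi]
    simp only [Finsupp.coe_add, Finsupp.coe_tsub, Pi.add_apply, Pi.sub_apply,
        Finsupp.coe_zero, Pi.zero_apply] at this
    omega

/-- Matrix multiplication: an entry of a product is a finite sum of products of entries. -/
lemma eventually_symb_mul (X : Finset (Fin n)) (b : SnAlg K n) :
    ∀ᶠ Γ : Finset (Fin n →₀ ℕ) in Filter.atTop, ∀ a, symb K X (a * b) =
      ∑ γ ∈ Γ with ∀ i ∈ X, γ i = 0,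
        symb K X (a * op K n γ ∅ 0) * symb K X (op K n 0 ∅ γ * b) := by
  induction b using op_induction with
  | zero => simp
  | add b c hb hc =>
    filter_upwards [hb, hc] with Γ hb hc a
    rw [mul_add, map_add, hb, hc, ← Finset.sum_add_distrib]
    simp only [mul_add, map_add]
  | smul c b hb =>
    filter_upwards [hb] with Γ hb a
    rw [mul_smul_comm, map_smul, hb, Finset.smul_sum]
    simp only [mul_smul_comm, map_smul]
  | hop α β =>
    filter_upwards [Filter.eventually_ge_atTop {outside X α}] with Γ hΓ a
    rw [Finset.sum_eq_single (outside X α), symb_mul_op]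
    · intro γ hγ hne
      rw [symb_op_mul_op_eq_zero β (Finset.mem_filter.1 hγ).2 hne, mul_zero]
    · intro h
      refine (h (Finset.mem_filter.2 ⟨hΓ (Finset.mem_singleton_self _), fun i hi => ?_⟩)).elim
      exact outside_of_mem α hi

/-- The positive part of an integral exponent vector. -/
def posExp {X : Finset (Fin n)} (m : X → ℤ) : Fin n →₀ ℕ :=
  Finsupp.equivFunOnFinite.symm fun i => if h : i ∈ X then (m ⟨i, h⟩).toNat else 0

lemma posExp_of_mem {X : Finset (Fin n)} (m : X → ℤ) {i : Fin n} (h : i ∈ X) :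
    posExp m i = (m ⟨i, h⟩).toNat := by simp [posExp, h]

lemma posExp_of_notMem {X : Finset (Fin n)} (m : X → ℤ) {i : Fin n} (h : i ∉ X) :
    posExp m i = 0 := by simp [posExp, h]

lemma relDeg_posExp {X : Finset (Fin n)} (m : X → ℤ) : relDeg X (posExp m) (posExp (-m)) = m := by
  ext ⟨i, hi⟩
  simp [relDeg, posExp_of_mem _ hi]

/-- The set of symbols of the elements of a two-sided ideal is an ideal. -/
def symbIdeal (X : Finset (Fin n)) (I : TwoSidedIdeal (SnAlg K n)) : Ideal (Laurent K X) where
  carrier := symb K X '' {a | a ∈ I}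
  add_mem' := by
    rintro _ _ ⟨a, ha, rfl⟩ ⟨b, hb, rfl⟩
    exact ⟨a + b, I.add_mem ha hb, map_add _ _ _⟩
  zero_mem' := ⟨0, I.zero_mem, map_zero _⟩
  smul_mem' := by
    rintro r _ ⟨a, ha, rfl⟩
    rw [smul_eq_mul]
    induction r using AddMonoidAlgebra.induction_on with
    | of m =>
      refine ⟨op K n (posExp m) ∅ (posExp (-m)) * a, I.mul_mem_left _ _ ha, ?_⟩
      rw [symb_op_mul (fun i hi => ⟨posExp_of_notMem _ hi, posExp_of_notMem _ hi⟩), relDeg_posExp]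
      rfl
    | add x y hx hy =>
      obtain ⟨b, hb, hb'⟩ := hx
      obtain ⟨c, hc, hc'⟩ := hy
      exact ⟨b + c, I.add_mem hb hc, by rw [map_add, hb', hc', add_mul]⟩
    | smul c x hx =>
      obtain ⟨b, hb, hb'⟩ := hx
      refine ⟨(c • 1) * b, I.mul_mem_left _ _ hb, ?_⟩
      rw [smul_mul_assoc, one_mul, map_smul, hb', smul_mul_assoc]

lemma symb_mem_symbIdeal (X : Finset (Fin n)) {I : TwoSidedIdeal (SnAlg K n)} {a : SnAlg K n}
    (h : a ∈ I) : symb K X a ∈ symbIdeal X I := ⟨a, h, rfl⟩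

lemma symbIdeal_le_mul {X : Finset (Fin n)} {I : TwoSidedIdeal (SnAlg K n)}
    (hI : tsiMul I I = I) : symbIdeal X I ≤ symbIdeal X I * symbIdeal X I := by
  rintro _ ⟨a, ha, rfl⟩
  have ha' : a ∈ tsiMul I I := by rw [hI]; exact ha
  refine map_mem_of_mem_span (symb K X).toAddMonoidHom
    (symbIdeal X I * symbIdeal X I).toAddSubgroup ?_ ha'
  rintro _ ⟨a, ha, b, hb, rfl⟩ u v
  obtain ⟨Γ, hΓ⟩ := (eventually_symb_mul X (b * v)).exists
  change symb K X (u * (a * b) * v) ∈ symbIdeal X I * symbIdeal X I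
  rw [show u * (a * b) * v = (u * a) * (b * v) by simp only [mul_assoc], hΓ]
  refine Ideal.sum_mem _ fun γ _ => Ideal.mul_mem_mul ?_ ?_
  · exact symb_mem_symbIdeal X (I.mul_mem_right _ _ (I.mul_mem_left _ _ ha))
  · exact symb_mem_symbIdeal X (I.mul_mem_left _ _ (I.mul_mem_right _ _ hb))

lemma symbIdeal_eq_bot_or_top {X : Finset (Fin n)} {I : TwoSidedIdeal (SnAlg K n)}
    (hI : tsiMul I I = I) : symbIdeal X I = ⊥ ∨ symbIdeal X I = ⊤ := by
  have : Algebra.FiniteType K (Laurent K X) := inferInstance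
  have : IsNoetherianRing (Laurent K X) := Algebra.FiniteType.isNoetherianRing K _
  rw [← Ideal.isIdempotentElem_iff_eq_bot_or_top _ (IsNoetherian.noetherian _)]
  exact le_antisymm Ideal.mul_le_right (symbIdeal_le_mul hI)

lemma eventually_compress_eq (X : Finset (Fin n)) (a : SnAlg K n) :
    ∀ᶠ N : ℕ in Filter.atTop,
      op K n 0 Xᶜ (posExp fun _ : X => N) * a * op K n (posExp fun _ : X => N) Xᶜ 0 =
        Finsupp.linearCombination K (fun m : X → ℤ => op K n (posExp m) Xᶜ (posExp (-m)))
          (symb K X a).coeff := by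
  induction a using op_induction with
  | zero => simp
  | add a b ha hb =>
    filter_upwards [ha, hb] with N ha hb
    rw [mul_add, add_mul, ha, hb, map_add, AddMonoidAlgebra.coeff_add, map_add]
  | smul c a ha =>
    filter_upwards [ha] with N ha
    rw [mul_smul_comm, smul_mul_assoc, ha, map_smul, AddMonoidAlgebra.coeff_smul, map_smul]
  | hop α β =>
    have : ∀ᶠ N : ℕ in Filter.atTop, ∀ i, α i ≤ N :=
      Filter.eventually_all.2 fun i => Filter.eventually_ge_atTop _
    filter_upwards [this] with N hN
    rw [symb_op_empty]
    by_cases h : ∀ i ∉ X, α i = 0 ∧ β i = 0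
    · rw [if_pos h, AddMonoidAlgebra.coeff_single, Finsupp.linearCombination_single, one_smul,
        op_mul_of, op_mul_of, Finset.union_empty, Finset.union_self]
      · congr 1 <;> ext i <;> by_cases hi : i ∈ X <;>
          simp [posExp_of_mem, posExp_of_notMem, hi, relDeg, h] <;>
          have := hN i <;> omega
      · intro i hi
        rw [Finset.union_empty] at hi
        simp [posExp_of_notMem _ (Finset.mem_compl.1 hi)]
      · intro i hi
        simp [posExp_of_notMem _ (Finset.mem_compl.1 hi), h i (Finset.mem_compl.1 hi)]
      · intro i hi
        simp [h i (Finset.mem_compl.1 hi)]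
      · simp
    · rw [if_neg h, AddMonoidAlgebra.coeff_zero, map_zero]
      push Not at h
      obtain ⟨i, hi, h⟩ := h
      rw [op_mul]
      split_ifs with h1
      · rw [op_mul, if_neg]
        rintro ⟨-, h2⟩
        have h1 := h1.1 i (Finset.mem_compl.2 hi)
        have h2 := h2 i (Finset.mem_compl.2 hi)
        simp only [Finsupp.coe_add, Finsupp.coe_tsub, Pi.add_apply, Pi.sub_apply,
          posExp_of_notMem _ hi] at h1 h2
        exact h (by omega) (by omega)
      · simp

/-- An idempotent ideal with a nonzero symbol on `X` contains `e_{Xᶜ}`. -/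
lemma op_compl_mem {X : Finset (Fin n)} {I : TwoSidedIdeal (SnAlg K n)} (hI : tsiMul I I = I)
    {a : SnAlg K n} (ha : a ∈ I) (h : symb K X a ≠ 0) : op K n 0 Xᶜ 0 ∈ I := by
  rcases symbIdeal_eq_bot_or_top (X := X) hI with h1 | h1
  · have := symb_mem_symbIdeal X ha
    rw [h1] at this
    exact (h this).elim
  · have h2 : (1 : Laurent K X) ∈ symbIdeal X I := by rw [h1]; trivial
    obtain ⟨b, hb, hb1⟩ := h2
    obtain ⟨N, hN⟩ := (eventually_compress_eq X b).exists
    rw [hb1, AddMonoidAlgebra.one_def, AddMonoidAlgebra.coeff_single,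
      Finsupp.linearCombination_single, one_smul] at hN
    have h0 : posExp (0 : X → ℤ) = 0 := by
      ext i; by_cases hi : i ∈ X <;> simp [posExp_of_mem, posExp_of_notMem, hi]
    rw [neg_zero, h0] at hN
    rw [← hN]
    exact I.mul_mem_right _ _ (I.mul_mem_left _ _ hb)

/-- The indices of the reduced spanning family `x^α e_{Xᶜ} y^β`. -/
def reducedIndices (n : ℕ) : Set (Finset (Fin n) × (Fin n →₀ ℕ) × (Fin n →₀ ℕ)) :=
  {p | ∀ i ∈ p.1, p.2.1 i = 0 ∨ p.2.2 i = 0}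

lemma mem_of_add_mem {M : Type*} [AddCommMonoid M] [Module K M] {S : Submodule K M} {a b : M}
    (ha : a ∈ S) (hab : a + b ∈ S) : b ∈ S := by
  have h : a + b + (-1 : K) • a = (1 + -1 : K) • a + b := by
    rw [add_smul, one_smul, add_right_comm]
  rw [add_neg_cancel, zero_smul, zero_add] at h
  exact h ▸ S.add_mem hab (S.smul_mem _ ha)

lemma smul_mem_twoSidedIdeal {R : Type*} [Ring R] [Algebra K R] (I : TwoSidedIdeal R) (c : K)
    {a : R} (ha : a ∈ I) : c • a ∈ I := by
  rw [Algebra.smul_def]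
  exact I.mul_mem_left _ _ ha

lemma op_compl_mem_span_reduced (d : ℕ) (X : Finset (Fin n)) (α β : Fin n →₀ ℕ)
    (hd : α.degree = d) : op K n α Xᶜ β ∈ Submodule.span K
      ((fun p : Finset (Fin n) × (Fin n →₀ ℕ) × (Fin n →₀ ℕ) => op K n p.2.1 p.1ᶜ p.2.2) ''
        reducedIndices n) := by
  induction d generalizing X α β with
  | zero =>
    refine Submodule.subset_span ⟨(X, α, β), fun i _ => ?_, rfl⟩
    rw [Finsupp.degree_eq_zero_iff] at hd
    simp [hd]
  | succ d ih =>
    by_cases h : ∀ i ∈ X, α i = 0 ∨ β i = 0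
    · exact Submodule.subset_span ⟨(X, α, β), h, rfl⟩
    · push Not at h
      obtain ⟨i, hi, hα, hβ⟩ := h
      have hα' : α - Finsupp.single i 1 + Finsupp.single i 1 = α :=
        tsub_add_cancel_of_le (Finsupp.single_le_iff.2 (Nat.one_le_iff_ne_zero.2 hα))
      have hβ' : β - Finsupp.single i 1 + Finsupp.single i 1 = β :=
        tsub_add_cancel_of_le (Finsupp.single_le_iff.2 (Nat.one_le_iff_ne_zero.2 hβ))
      have hd' : (α - Finsupp.single i 1).degree = d := by
        have := congrArg Finsupp.degree hα'
        rw [map_add, Finsupp.degree_single, hd] at this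
        omega
      have key := op_insert_add (K := K) (α - Finsupp.single i 1) (β - Finsupp.single i 1)
        (Y := Xᶜ) (i := i) (by simpa using hi)
      rw [hα', hβ', ← Finset.compl_erase] at key
      have h1 := ih (X.erase i) _ (β - Finsupp.single i 1) hd'
      have h2 := ih X _ (β - Finsupp.single i 1) hd'
      rw [← key] at h2
      exact mem_of_add_mem h1 h2

lemma exists_reduced_expansion (a : SnAlg K n) :
    ∃ l : Finset (Fin n) × (Fin n →₀ ℕ) × (Fin n →₀ ℕ) →₀ K,
      (∀ p ∈ l.support, p ∈ reducedIndices n) ∧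
        a = ∑ p ∈ l.support, l p • op K n p.2.1 p.1ᶜ p.2.2 := by
  have : a ∈ Submodule.span K
      ((fun p : Finset (Fin n) × (Fin n →₀ ℕ) × (Fin n →₀ ℕ) => op K n p.2.1 p.1ᶜ p.2.2) ''
        reducedIndices n) := by
    induction a using op_induction with
    | hop α β => simpa using op_compl_mem_span_reduced (K := K) _ Finset.univ α β rfl
    | zero => exact zero_mem _
    | add a b ha hb => exact add_mem ha hb
    | smul c a ha => exact Submodule.smul_mem _ c ha
  obtain ⟨l, hl, hl'⟩ := (Finsupp.mem_span_image_iff_linearCombination K).1 this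
  exact ⟨l, fun p hp => (Finsupp.mem_supported _ _).1 hl hp, hl'.symm⟩

/-- The coefficient extracted by the reduced monomial `x^α e_{Xᶜ} y^β`. -/
def entry (X : Finset (Fin n)) (α β : Fin n →₀ ℕ) : SnAlg K n →ₗ[K] K where
  toFun a := (symb K X (op K n 0 ∅ (outside X α) * a * op K n (outside X β) ∅ 0)).coeff
    (relDeg X α β)
  map_add' a b := by
    rw [mul_add, add_mul, map_add, AddMonoidAlgebra.coeff_add, Finsupp.add_apply]
  map_smul' c a := by
    rw [mul_smul_comm, smul_mul_assoc, map_smul, AddMonoidAlgebra.coeff_smul, Finsupp.smul_apply,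
      RingHom.id_apply]

lemma entry_of_not_subset {X X' : Finset (Fin n)} (h : ¬ X ⊆ X') (α β α' β' : Fin n →₀ ℕ) :
    entry X α β (op K n α' X'ᶜ β') = 0 := by
  change (symb K X _).coeff _ = _
  rw [op_mul]
  split_ifs
  · rw [op_mul]
    split_ifs
    · rw [symb_op, if_neg]
      · simp
      · rintro ⟨h', -⟩
        rw [Finset.empty_union, Finset.union_empty, disjoint_compl_left_iff] at h'
        exact h h'
    · simp
  · simp

lemma symb_extract (X : Finset (Fin n)) (α β α' β' : Fin n →₀ ℕ) :
    symb K X (op K n 0 ∅ (outside X α) * op K n α' Xᶜ β' * op K n (outside X β) ∅ 0) =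
      if ∀ i ∉ X, α' i = α i ∧ β' i = β i then
        AddMonoidAlgebra.single (relDeg X α' β') 1 else 0 := by
  by_cases h : ∀ i ∉ X, α' i = α i ∧ β' i = β i
  · rw [if_pos h, op_mul_of, op_mul_of, symb_op, if_pos]
    · congr 1
      ext ⟨i, hi⟩
      simp [relDeg, outside_of_mem _ hi]
    · refine ⟨by simp [disjoint_compl_left], fun i hi => ?_⟩
      simp [outside_of_notMem _ hi, h i hi]
    · intro i hi
      have hi' : i ∉ X := by simpa using hi
      simp [outside_of_notMem _ hi', h i hi']
    · simp
    · simp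
    · intro i hi
      have hi' : i ∉ X := by simpa using hi
      simp [outside_of_notMem _ hi', h i hi']
  · rw [if_neg h]
    rw [op_mul]
    split_ifs with h1
    · rw [op_mul]
      split_ifs with h2
      · rw [symb_op, if_neg]
        rintro ⟨-, h3⟩
        refine h fun i hi => ?_
        have h1 := h1.2 i (Finset.mem_compl.2 hi)
        have h2 := h2.1 i (by simpa using hi)
        have h3 := h3 i hi
        simp only [Finsupp.coe_add, Finsupp.coe_tsub, Pi.add_apply, Pi.sub_apply,
          outside_of_notMem _ hi, Finsupp.coe_zero, Pi.zero_apply] at h1 h2 h3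
        omega
      · simp
    · simp

lemma entry_self (X : Finset (Fin n)) (α β : Fin n →₀ ℕ) :
    entry X α β (op K n α Xᶜ β) = 1 := by
  change (symb K X _).coeff _ = _
  rw [symb_extract, if_pos (by simp), AddMonoidAlgebra.coeff_single, Finsupp.single_eq_same]

lemma entry_of_ne {X : Finset (Fin n)} {α β α' β' : Fin n →₀ ℕ}
    (h : (X, α, β) ∈ reducedIndices n) (h' : (X, α', β') ∈ reducedIndices n)
    (hne : (α', β') ≠ (α, β)) : entry X α β (op K n α' Xᶜ β') = 0 := by
  change (symb K X _).coeff _ = _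
  rw [symb_extract]
  split_ifs with h1
  · rw [AddMonoidAlgebra.coeff_single, Finsupp.single_eq_of_ne]
    intro h2
    have : ∀ i, α' i = α i ∧ β' i = β i := fun i => by
      by_cases hi : i ∈ X
      · have h2 := congrFun h2 ⟨i, hi⟩
        have h := h i hi
        have h' := h' i hi
        simp only [relDeg] at h h' h2
        omega
      · exact h1 i hi
    exact hne (Prod.ext (Finsupp.ext fun i => (this i).1) (Finsupp.ext fun i => (this i).2))
  · simp

lemma op_zero_mul_op_zero (Y Y' : Finset (Fin n)) :
    op K n 0 Y 0 * op K n 0 Y' 0 = op K n 0 (Y ∪ Y') 0 := by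
  rw [op_mul_of (by simp) (by simp)]
  simp

lemma op_mem_of_op_zero_mem {I : TwoSidedIdeal (SnAlg K n)} {Y : Finset (Fin n)}
    (h : op K n 0 Y 0 ∈ I) (α β : Fin n →₀ ℕ) : op K n α Y β ∈ I := by
  have := I.mul_mem_right _ (op K n 0 ∅ β) (I.mul_mem_left (op K n α ∅ 0) _ h)
  rw [op_mul_of (by simp) (by simp), op_mul_of (by simp) (by simp)] at this
  simpa using this

lemma op_zero_mem_of_subset {I : TwoSidedIdeal (SnAlg K n)} {Y Y' : Finset (Fin n)}
    (h : op K n 0 Y 0 ∈ I) (hY : Y ⊆ Y') : op K n 0 Y' 0 ∈ I := by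
  have := I.mul_mem_left (op K n 0 Y' 0) _ h
  rwa [op_zero_mul_op_zero, Finset.union_eq_left.2 hY] at this

lemma exists_maximal_fst {ι κ : Type*} [PartialOrder ι] {s : Finset (ι × κ)} {P : ι → Prop}
    (h : ∃ p ∈ s, P p.1) : ∃ p ∈ s, P p.1 ∧ ∀ q ∈ s, P q.1 → p.1 ≤ q.1 → q.1 = p.1 := by
  classical
  obtain ⟨p₀, hp₀, hp₀'⟩ := h
  obtain ⟨i, hi⟩ := ((s.filter fun p => P p.1).image Prod.fst).exists_maximal
    ⟨p₀.1, Finset.mem_image_of_mem _ (Finset.mem_filter.2 ⟨hp₀, hp₀'⟩)⟩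
  obtain ⟨p, hp, rfl⟩ := Finset.mem_image.1 hi.1
  obtain ⟨hp, hP⟩ := Finset.mem_filter.1 hp
  exact ⟨p, hp, hP, fun q hq hQ hle => (hi.eq_of_le
    (Finset.mem_image_of_mem Prod.fst (Finset.mem_filter.2 ⟨hq, hQ⟩)) hle).symm⟩

/-- An idempotent ideal is generated by the idempotents `e_Y` it contains. -/
lemma le_of_op_zero_mem {I J : TwoSidedIdeal (SnAlg K n)} (hI : tsiMul I I = I)
    (h : ∀ X : Finset (Fin n), op K n 0 Xᶜ 0 ∈ I → op K n 0 Xᶜ 0 ∈ J) : I ≤ J := by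
  intro a ha
  obtain ⟨l, hl, rfl⟩ := exists_reduced_expansion a
  by_cases hbad : ∀ p ∈ l.support, op K n 0 p.1ᶜ 0 ∈ I
  · refine sum_mem fun p hp => ?_
    exact smul_mem_twoSidedIdeal J _ (op_mem_of_op_zero_mem (h _ (hbad p hp)) p.2.1 p.2.2)
  · exfalso
    push Not at hbad
    obtain ⟨⟨X, α, β⟩, hp, hpI, hmax⟩ :=
      exists_maximal_fst (P := fun X => op K n 0 Xᶜ 0 ∉ I) hbad
    have key : entry X α β (∑ p ∈ l.support, l p • op K n p.2.1 p.1ᶜ p.2.2) = l (X, α, β) := by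
      rw [map_sum, Finset.sum_eq_single (X, α, β)]
      · rw [map_smul, entry_self, smul_eq_mul, mul_one]
      · rintro ⟨X', α', β'⟩ hq hne
        rw [map_smul]
        by_cases hXX : X ⊆ X'
        · have hqI : op K n 0 X'ᶜ 0 ∉ I := fun hqI =>
            hpI (op_zero_mem_of_subset hqI (Finset.compl_subset_compl.2 hXX))
          obtain rfl : X' = X := hmax _ hq hqI hXX
          rw [entry_of_ne (hl _ hp) (hl _ hq) (fun h => hne (by rw [h])), smul_zero]
        · rw [entry_of_not_subset hXX, smul_zero]
      · exact fun h => (h hp).elim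
    refine hpI (op_compl_mem hI (I.mul_mem_right _ (op K n (outside X β) ∅ 0)
      (I.mul_mem_left (op K n 0 ∅ (outside X α)) _ ha)) fun h0 => ?_)
    refine Finsupp.mem_support_iff.1 hp (key.symm.trans ?_)
    change (symb K X _).coeff _ = _
    rw [h0]
    simp

lemma tsiMul_mono {R : Type*} [Ring R] {I I' J J' : TwoSidedIdeal R} (hI : I ≤ I') (hJ : J ≤ J') :
    tsiMul I J ≤ tsiMul I' J' := by
  refine TwoSidedIdeal.span_mono ?_
  rintro _ ⟨a, ha, b, hb, rfl⟩
  exact ⟨a, hI ha, b, hJ hb, rfl⟩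

lemma tsiMul_le_left {R : Type*} [Ring R] (I J : TwoSidedIdeal R) : tsiMul I J ≤ I := by
  refine TwoSidedIdeal.span_le.2 ?_
  rintro _ ⟨a, ha, b, _, rfl⟩
  exact I.mul_mem_right _ _ ha

lemma mul_mem_tsiMul {R : Type*} [Ring R] {I J : TwoSidedIdeal R} {a b : R} (ha : a ∈ I)
    (hb : b ∈ J) : a * b ∈ tsiMul I J := TwoSidedIdeal.subset_span ⟨a, ha, b, hb, rfl⟩

lemma tsiMul_span_singleton_le {R : Type*} [Ring R] {a b : R} {Q : TwoSidedIdeal R}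
    (h : ∀ s, a * s * b ∈ Q) :
    tsiMul (TwoSidedIdeal.span {a}) (TwoSidedIdeal.span {b}) ≤ Q := by
  have h1 : ∀ x ∈ TwoSidedIdeal.span {a}, ∀ s, x * s * b ∈ Q := by
    intro x hx
    refine TwoSidedIdeal.span_induction (p := fun x _ => ∀ s, x * s * b ∈ Q) ?_ ?_ ?_ ?_ ?_ ?_ hx
    · rintro _ rfl; exact h
    · intro s; rw [zero_mul, zero_mul]; exact Q.zero_mem
    · intro x y _ _ hx hy s; rw [add_mul, add_mul]; exact Q.add_mem (hx s) (hy s)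
    · intro x _ hx s; rw [neg_mul, neg_mul]; exact Q.neg_mem (hx s)
    · intro r x _ hx s; rw [mul_assoc r, mul_assoc r]; exact Q.mul_mem_left _ _ (hx s)
    · intro r x _ hx s; rw [mul_assoc x]; exact hx _
  refine TwoSidedIdeal.span_le.2 ?_
  rintro _ ⟨x, hx, y, hy, rfl⟩
  refine TwoSidedIdeal.span_induction
    (p := fun y _ => ∀ x ∈ TwoSidedIdeal.span {a}, x * y ∈ Q) ?_ ?_ ?_ ?_ ?_ ?_ hy x hx
  · rintro _ rfl x hx
    simpa using h1 x hx 1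
  · intro x _; rw [mul_zero]; exact Q.zero_mem
  · intro y z _ _ hy hz x hx; rw [mul_add]; exact Q.add_mem (hy x hx) (hz x hx)
  · intro y _ hy x hx; rw [mul_neg]; exact Q.neg_mem (hy x hx)
  · intro r y _ hy x hx
    rw [← mul_assoc]
    exact hy _ (TwoSidedIdeal.mul_mem_right _ _ _ hx)
  · intro r y _ hy x hx
    rw [← mul_assoc]
    exact Q.mul_mem_right _ _ (hy x hx)

/-- The ideal generated by `e_Y = ∏_{i ∈ Y} (1 - x_i y_i)`. -/
def eIdeal (K : Type u) [Field K] (n : ℕ) (Y : Finset (Fin n)) : TwoSidedIdeal (SnAlg K n) :=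
  TwoSidedIdeal.span {op K n 0 Y 0}

lemma op_zero_mem_eIdeal (Y : Finset (Fin n)) : op K n 0 Y 0 ∈ eIdeal K n Y :=
  TwoSidedIdeal.subset_span rfl

lemma eIdeal_le_iff {I : TwoSidedIdeal (SnAlg K n)} {Y : Finset (Fin n)} :
    eIdeal K n Y ≤ I ↔ op K n 0 Y 0 ∈ I := by
  rw [eIdeal, TwoSidedIdeal.span_le, Set.singleton_subset_iff, SetLike.mem_coe]

lemma tsiMul_eIdeal (Y Y' : Finset (Fin n)) :
    tsiMul (eIdeal K n Y) (eIdeal K n Y') = eIdeal K n (Y ∪ Y') := by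
  refine le_antisymm (tsiMul_span_singleton_le fun s => ?_) (eIdeal_le_iff.2 ?_)
  · induction s using op_induction with
    | zero => simp
    | add a b ha hb => rw [mul_add, add_mul]; exact TwoSidedIdeal.add_mem _ ha hb
    | smul c a ha =>
      rw [mul_smul_comm, smul_mul_assoc]
      exact smul_mem_twoSidedIdeal _ c ha
    | hop α β =>
      rw [op_mul]
      split_ifs
      · rw [op_mul]
        split_ifs
        · rw [Finset.union_empty]
          exact op_mem_of_op_zero_mem (op_zero_mem_eIdeal _) _ _
        · exact TwoSidedIdeal.zero_mem _
      · rw [zero_mul]; exact TwoSidedIdeal.zero_mem _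
  · rw [← op_zero_mul_op_zero]
    exact mul_mem_tsiMul (op_zero_mem_eIdeal _) (op_zero_mem_eIdeal _)

lemma eIdeal_empty : eIdeal K n ∅ = ⊤ := by
  refine top_le_iff.1 fun a _ => ?_
  have := (eIdeal K n ∅).mul_mem_left a _ (op_zero_mem_eIdeal ∅)
  rwa [op_one, mul_one] at this

lemma qIdeal_eq (X : Finset (Fin n)) : qIdeal K n X = eIdeal K n Xᶜ := by
  have key : ∀ l : List (Fin n),
      l.foldr (fun i J => tsiMul (pIdeal K n i) J) ⊤ = eIdeal K n l.toFinset := by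
    intro l
    induction l with
    | nil => exact eIdeal_empty.symm
    | cons i l ih =>
      have hp : pIdeal K n i = eIdeal K n {i} := by rw [pIdeal, one_sub_xS_mul_yS, eIdeal]
      rw [List.foldr_cons, ih, hp, tsiMul_eIdeal, List.toFinset_cons, Finset.insert_eq]
  rw [qIdeal, key, Finset.sort_toFinset]

lemma qIdeal_le_iff {I : TwoSidedIdeal (SnAlg K n)} {X : Finset (Fin n)} :
    qIdeal K n X ≤ I ↔ op K n 0 Xᶜ 0 ∈ I := by rw [qIdeal_eq, eIdeal_le_iff]

lemma qIdeal_mono {X X' : Finset (Fin n)} (h : X ⊆ X') : qIdeal K n X ≤ qIdeal K n X' := by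
  rw [qIdeal_le_iff, qIdeal_eq]
  exact op_zero_mem_of_subset (op_zero_mem_eIdeal _) (Finset.compl_subset_compl.2 h)

lemma qIdeal_le_antichainIdeal {C : Finset (Finset (Fin n))} {X : Finset (Fin n)} (h : X ∈ C) :
    qIdeal K n X ≤ antichainIdeal K n C := le_iSup₂_of_le X h le_rfl

lemma antichainIdeal_eq_span (C : Finset (Finset (Fin n))) :
    antichainIdeal K n C = TwoSidedIdeal.span {a | ∃ X ∈ C, a = op K n 0 Xᶜ 0} := by
  refine le_antisymm (iSup₂_le fun X hX => qIdeal_le_iff.2 ?_) (TwoSidedIdeal.span_le.2 ?_)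
  · exact TwoSidedIdeal.subset_span ⟨X, hX, rfl⟩
  · rintro _ ⟨X, hX, rfl⟩
    exact qIdeal_le_iff.1 (qIdeal_le_antichainIdeal hX)

lemma antichainIdeal_idempotent (C : Finset (Finset (Fin n))) :
    tsiMul (antichainIdeal K n C) (antichainIdeal K n C) = antichainIdeal K n C := by
  refine le_antisymm (tsiMul_le_left _ _) (iSup₂_le fun X hX => ?_)
  calc qIdeal K n X = tsiMul (qIdeal K n X) (qIdeal K n X) := by
        rw [qIdeal_eq, tsiMul_eIdeal, Finset.union_self]
    _ ≤ _ := tsiMul_mono (qIdeal_le_antichainIdeal hX) (qIdeal_le_antichainIdeal hX)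

lemma qIdeal_le_antichainIdeal_iff {C : Finset (Finset (Fin n))} {X : Finset (Fin n)} :
    qIdeal K n X ≤ antichainIdeal K n C ↔ ∃ Y ∈ C, X ⊆ Y := by
  refine ⟨fun h => ?_, fun ⟨Y, hY, h⟩ => (qIdeal_mono h).trans (qIdeal_le_antichainIdeal hY)⟩
  by_contra! hC
  rw [qIdeal_le_iff, antichainIdeal_eq_span] at h
  have h0 := map_mem_of_mem_span (symb K X).toAddMonoidHom ⊥ (x := op K n 0 Xᶜ 0) ?_ h
  · have h1 : symb K X (op K n 0 Xᶜ 0) = 0 := h0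
    rw [symb_op, if_pos (by simp [disjoint_compl_left]), AddMonoidAlgebra.single_eq_zero] at h1
    exact one_ne_zero h1
  · rintro _ ⟨Y, hY, rfl⟩ u v
    refine symb_mul_op_mul_eq_zero (fun h' => hC Y hY ?_) u v
    rwa [disjoint_compl_left_iff] at h'

lemma antichainIdeal_injOn : Set.InjOn (antichainIdeal K n)
    {C : Finset (Finset (Fin n)) | IsAntichain (· ⊆ ·) (C : Set (Finset (Fin n)))} := by
  have key : ∀ C C' : Finset (Finset (Fin n)), IsAntichain (· ⊆ ·) (C : Set (Finset (Fin n))) →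
      antichainIdeal K n C = antichainIdeal K n C' → C ⊆ C' := by
    intro C C' hC h X hX
    obtain ⟨Y, hY, hXY⟩ := qIdeal_le_antichainIdeal_iff.1 (h ▸ qIdeal_le_antichainIdeal (K := K) hX)
    obtain ⟨Z, hZ, hYZ⟩ :=
      qIdeal_le_antichainIdeal_iff.1 (h ▸ qIdeal_le_antichainIdeal (K := K) hY)
    have hXZ : X = Z := hC.eq hX hZ (hXY.trans hYZ)
    rwa [hXY.antisymm (hXZ ▸ hYZ)]
  intro C hC C' hC' h
  exact (key C C' hC h).antisymm (key C' C hC' h.symm)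

lemma exists_antichain {I : TwoSidedIdeal (SnAlg K n)} (hI : tsiMul I I = I) :
    ∃ C : Finset (Finset (Fin n)), IsAntichain (· ⊆ ·) (C : Set (Finset (Fin n))) ∧
      antichainIdeal K n C = I := by
  classical
  refine ⟨Finset.univ.filter fun X => Maximal (fun X : Finset (Fin n) => qIdeal K n X ≤ I) X,
    ?_, le_antisymm (iSup₂_le fun X hX => ?_) (le_of_op_zero_mem hI fun X hX => ?_)⟩
  · simpa using setOfPred_maximal_antichain fun X : Finset (Fin n) => qIdeal K n X ≤ I
  · exact (Finset.mem_filter.1 hX).2.1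
  · rw [← qIdeal_le_iff] at hX ⊢
    obtain ⟨Y, hXY, hY⟩ :=
      (Set.toFinite {X : Finset (Fin n) | qIdeal K n X ≤ I}).exists_le_maximal hX
    exact qIdeal_le_antichainIdeal_iff.2 ⟨Y, by simpa using hY, hXY⟩

end OneSided

/-- `C ↦ Σ_{X ∈ C} q_X` is a bijection from the antichains of subsets of
`{1, …, n}` onto the idempotent two-sided ideals of `S_n`; in particular the set of
idempotent ideals of `S_n` is finite and its cardinality is the Dedekind number `d_n`, the
number of antichains of subsets of an `n`-element set. -/
theorem statement19 (K : Type u) [Field K] (n : ℕ) (hn : 0 < n) :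
    Set.BijOn (antichainIdeal K n)
      {C : Finset (Finset (Fin n)) | IsAntichain (· ⊆ ·) (C : Set (Finset (Fin n)))}
      {I : TwoSidedIdeal (SnAlg K n) | tsiMul I I = I} ∧
    {I : TwoSidedIdeal (SnAlg K n) | tsiMul I I = I}.Finite ∧
    Set.ncard {I : TwoSidedIdeal (SnAlg K n) | tsiMul I I = I} =
      Set.ncard {C : Finset (Finset (Fin n)) | IsAntichain (· ⊆ ·) (C : Set (Finset (Fin n)))} := by
  have h : Set.BijOn (antichainIdeal K n)
      {C : Finset (Finset (Fin n)) | IsAntichain (· ⊆ ·) (C : Set (Finset (Fin n)))}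
      {I : TwoSidedIdeal (SnAlg K n) | tsiMul I I = I} :=
    ⟨fun C _ => OneSided.antichainIdeal_idempotent C, OneSided.antichainIdeal_injOn,
      fun I hI => OneSided.exists_antichain hI⟩
  refine ⟨h, ?_, ?_⟩
  · rw [← h.image_eq]
    exact (Set.toFinite _).image _
  · rw [← h.image_eq, h.injOn.ncard_image]
end
end
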